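/- arXiv:2502.02953 — 2 statements merged into one kernel-verified Lean document; each statement's English description precedes it below -/
import Mathlib

section
/- Fix L > 0, r > 0, θ ∈ [−1, 1], ν = √(1 − θ²). Let S_{x,θ}^r be the set of x ∈ ℝⁿ with all entries nonzero, no entry in the open interval (−Lr, Lr), and (x − rZ(x))ᵀZ(x) = θ‖x − rZ(x)‖‖Z(x)‖. Let S_d ⊆ ℝ^m and S_u ⊆ ℝ^m be compact, let S̃ be a compact subset of S_{x,θ}^r, and let S_γ ⊆ ℝ be either compact or equal to ℝ. Let ψ : S_d × S̃ × S_u × S_γ → ℝ be continuous. Let G be an m×n matrix with i.i.d. standard Gaussian entries and g, f ∈ ℝ^m, h ∈ ℝⁿ standard Gaussian vectors, all mutually independent. Define Y(d,x,u,γ) = uᵀG(x − rZ(x)) + γ·uᵀG Z(x) + ψ(d,x,u,γ) and W(d,x,u,γ) = ‖x − rZ(x)‖·gᵀu − ‖u‖·hᵀ(x − rZ(x)) + γ‖Z(x)‖·(θg + νf)ᵀu − |γ|·‖u‖·hᵀZ(x) + ψ(d,x,u,γ). Then for every t ∈ ℝ: P[ min_{d ∈ S_d, x ∈ S̃} sup_{u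 ∈ S_u, γ ∈ S_γ} Y(d,x,u,γ) ≤ t ] ≤ 4·P[ min_{d ∈ S_d, x ∈ S̃} sup_{u ∈ S_u, γ ∈ S_γ} W(d,x,u,γ) ≤ t ]. -/
open MeasureTheory ProbabilityTheory Real
open scoped ENNReal NNReal

/-- One-bit quantization `Z(v) = L · sign(v)` applied entrywise. -/
noncomputable def Zv {n : ℕ} (L : ℝ) (x : Fin n → ℝ) : Fin n → ℝ :=
  fun i => L * Real.sign (x i)

/-- Euclidean dot product. -/
noncomputable def dotp {k : ℕ} (a b : Fin k → ℝ) : ℝ := ∑ i, a i * b i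

/-- Euclidean norm. -/
noncomputable def nrm {k : ℕ} (a : Fin k → ℝ) : ℝ := Real.sqrt (∑ i, (a i) ^ 2)

/-- `x − r Z(x)`. -/
noncomputable def xr {n : ℕ} (L r : ℝ) (x : Fin n → ℝ) : Fin n → ℝ :=
  fun i => x i - r * (L * Real.sign (x i))

/-- Matrix–vector product. -/
noncomputable def mulV {m n : ℕ} (H : Fin m → Fin n → ℝ) (x : Fin n → ℝ) : Fin m → ℝ :=
  fun k => ∑ i, H k i * x i

/-- Law of an `m × n` random matrix with i.i.d. standard Gaussian entries. -/
noncomputable def stdMat (m n : ℕ) : Measure (Fin m → Fin n → ℝ) :=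
  Measure.pi fun _ : Fin m => Measure.pi fun _ : Fin n => gaussianReal 0 1

/-- Law of a vector of `k` i.i.d. standard Gaussian entries. -/
noncomputable def stdVec (k : ℕ) : Measure (Fin k → ℝ) :=
  Measure.pi fun _ : Fin k => gaussianReal 0 1


/-- A comparison of min-max events over finite subfamilies of two processes passes to a
compact minimization set and a separable maximization set. -/
theorem measure_exists_forall_le_of_finite {Ω C T : Type*} [MeasurableSpace Ω] (P : Measure Ω)
    [IsFiniteMeasure P] [TopologicalSpace C] [CompactSpace C]
    [TopologicalSpace.SeparableSpace C] [Nonempty C] [TopologicalSpace T]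
    [TopologicalSpace.SeparableSpace T] [Nonempty T] (F H : Ω → C → T → ℝ)
    (hF : ∀ ω τ, Continuous fun c => F ω c τ) (hH : ∀ ω τ, Continuous fun c => H ω c τ)
    (hH' : ∀ ω c, Continuous fun τ => H ω c τ) (hHm : ∀ c τ, Measurable fun ω => H ω c τ)
    (K : ℝ≥0∞) (hK : K ≠ ⊤)
    (hfin : ∀ (N k : ℕ) (c : Fin N → C) (τ : Fin k → T) (s : ℝ),
      P {ω | ∃ i, ∀ j, F ω (c i) (τ j) < s} ≤ K * P {ω | ∃ i, ∀ j, H ω (c i) (τ j) ≤ s})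
    (t : ℝ) :
    P {ω | ∃ c, ∀ τ, F ω c τ ≤ t} ≤ K * P {ω | ∃ c, ∀ τ, H ω c τ ≤ t} := by
  set c := TopologicalSpace.denseSeq C
  set σ := TopologicalSpace.denseSeq T
  have hc : DenseRange c := TopologicalSpace.denseRange_denseSeq C
  have hσ : DenseRange σ := TopologicalSpace.denseRange_denseSeq T
  set ε : ℕ → ℝ := fun k => t + 1 / ((k : ℝ) + 1)
  have hεt : ∀ k, t < ε k := fun k => by
    have : 0 < 1 / ((k : ℝ) + 1) := by positivity
    simp only [ε]; linarith
  have hεa : Antitone ε := fun k l hkl => by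
    simp only [ε]
    gcongr
  have hεl : Filter.Tendsto ε Filter.atTop (nhds t) := by
    simpa [ε] using (tendsto_one_div_add_atTop_nhds_zero_nat (𝕜 := ℝ)).const_add t
  let B : ℕ → Set Ω := fun k => {ω | ∃ i : ℕ, ∀ j : Fin k, H ω (c i) (σ j) ≤ ε k}
  have hBm : ∀ k, MeasurableSet (B k) := fun k => by
    simp only [B, Set.ofPred_exists, Set.ofPred_forall]
    exact MeasurableSet.iUnion fun i => MeasurableSet.iInter fun j =>
      measurableSet_le (hHm _ _) measurable_const
  have hBa : Antitone B := fun k l hkl ω ⟨i, hi⟩ =>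
    ⟨i, fun j => (hi ⟨j, j.2.trans_le hkl⟩).trans (hεa hkl)⟩
  have hBi : ⋂ k, B k ⊆ {ω | ∃ c, ∀ τ, H ω c τ ≤ t} := by
    intro ω hω
    rw [Set.mem_iInter] at hω
    let S : ℕ → Set C := fun k => {x | ∀ j : Fin k, H ω x (σ j) ≤ ε k}
    have hS : (⋂ k, S k).Nonempty := by
      have hcl : ∀ k, IsClosed (S k) := fun k => by
        simp only [S, Set.ofPred_forall]
        exact isClosed_iInter fun j => isClosed_le (hH _ _) continuous_const
      refine IsCompact.nonempty_iInter_of_sequence_nonempty_isCompact_isClosed S ?_ ?_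
        (hcl 0).isCompact hcl
      · intro k x hx j
        exact (hx ⟨j, by omega⟩).trans (hεa (Nat.le_succ k))
      · intro k
        obtain ⟨i, hi⟩ := hω k
        exact ⟨c i, hi⟩
    obtain ⟨x, hx⟩ := hS
    rw [Set.mem_iInter] at hx
    have hxj : ∀ j, H ω x (σ j) ≤ t := fun j => by
      refine ge_of_tendsto hεl ?_
      filter_upwards [Filter.eventually_gt_atTop j] with k hk
      exact hx k ⟨j, hk⟩
    refine ⟨x, fun τ => ?_⟩
    exact hσ.induction_on (p := fun τ => H ω x τ ≤ t) τ
      (isClosed_le (hH' ω x) continuous_const) hxj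
  have hlim : Filter.Tendsto (fun k => K * P (B k)) Filter.atTop (nhds (K * P (⋂ k, B k))) :=
    ENNReal.Tendsto.const_mul (tendsto_measure_iInter_atTop
      (fun k => (hBm k).nullMeasurableSet) hBa ⟨0, measure_ne_top _ _⟩) (Or.inr hK)
  refine le_trans (ge_of_tendsto' hlim fun k => ?_) (mul_le_mul_right (measure_mono hBi) K)
  have hA : {ω | ∃ c, ∀ τ, F ω c τ ≤ t} ⊆
      ⋃ N : ℕ, {ω | ∃ i : Fin N, ∀ j : Fin k, F ω (c i) (σ j) < ε k} := by
    rintro ω ⟨x, hx⟩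
    have hopen : IsOpen {y | ∀ j : Fin k, F ω y (σ j) < ε k} := by
      simp only [Set.ofPred_forall]
      exact isOpen_iInter_of_finite fun j => isOpen_lt (hF _ _) continuous_const
    obtain ⟨i, hi⟩ := hc.exists_mem_open hopen ⟨x, fun j => (hx _).trans_lt (hεt k)⟩
    exact Set.mem_iUnion.2 ⟨i + 1, ⟨i, Nat.lt_succ_self i⟩, hi⟩
  refine (measure_mono hA).trans ?_
  rw [Monotone.measure_iUnion]
  · refine iSup_le fun N => (hfin N k (fun i => c i) (fun j => σ j) (ε k)).trans ?_
    refine mul_le_mul_right (measure_mono ?_) K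
    rintro ω ⟨i, hi⟩
    exact ⟨i, hi⟩
  · rintro N M hNM ω ⟨i, hi⟩
    exact ⟨⟨i, i.2.trans_le hNM⟩, hi⟩

open scoped Matrix

/-- `ξ` is a family of independent standard Gaussian variables, expressed through the
characteristic function. -/
def IsStdGaussianFamily {Ω κ : Type*} [MeasurableSpace Ω] [Fintype κ] (P : Measure Ω)
    (ξ : κ → Ω → ℝ) : Prop :=
  (∀ k, Measurable (ξ k)) ∧ ∀ c : κ → ℝ,
    ∫ ω, Complex.exp (((∑ k, c k * ξ k ω : ℝ) : ℂ) * Complex.I) ∂P =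
      Complex.exp (-((∑ k, c k ^ 2 : ℝ) : ℂ) / 2)

theorem isStdGaussianFamily_pi {κ : Type*} [Fintype κ] :
    IsStdGaussianFamily (Measure.pi fun _ : κ => gaussianReal 0 1) (fun k x => x k) := by
  refine ⟨fun k => measurable_pi_apply k, fun c => ?_⟩
  have h : ∀ x : κ → ℝ, Complex.exp (((∑ k, c k * x k : ℝ) : ℂ) * Complex.I) =
      ∏ k, Complex.exp ((c k : ℂ) * (x k : ℂ) * Complex.I) := fun x => by
    rw [← Complex.exp_sum, Complex.ofReal_sum, Finset.sum_mul]
    simp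
  simp_rw [h]
  rw [integral_fintype_prod_eq_prod (f := fun k (y : ℝ) =>
    Complex.exp ((c k : ℂ) * (y : ℂ) * Complex.I))]
  simp_rw [← charFun_apply_real, charFun_gaussianReal]
  rw [← Complex.exp_sum]
  congr 1
  push_cast
  rw [← Finset.sum_neg_distrib, Finset.sum_div]
  exact Finset.sum_congr rfl fun k _ => by simp [neg_div]

theorem isStdGaussianFamily_stdMat (m n : ℕ) :
    IsStdGaussianFamily (Measure.pi fun _ : Fin m => Measure.pi fun _ : Fin n => gaussianReal 0 1)
      (fun (k : Fin m × Fin n) G => G k.1 k.2) := by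
  refine ⟨fun k => by fun_prop, fun c => ?_⟩
  have h : ∀ G : Fin m → Fin n → ℝ,
      Complex.exp (((∑ k : Fin m × Fin n, c k * G k.1 k.2 : ℝ) : ℂ) * Complex.I) =
      ∏ i, Complex.exp (((∑ j, c (i, j) * G i j : ℝ) : ℂ) * Complex.I) := fun x => by
    rw [← Complex.exp_sum, Fintype.sum_prod_type, Complex.ofReal_sum, Finset.sum_mul]
  simp_rw [h]
  rw [integral_fintype_prod_eq_prod (f := fun i (y : Fin n → ℝ) =>
    Complex.exp (((∑ j, c (i, j) * y j : ℝ) : ℂ) * Complex.I))]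
  simp_rw [isStdGaussianFamily_pi.2]
  rw [← Complex.exp_sum, Fintype.sum_prod_type]
  congr 1
  push_cast
  rw [← Finset.sum_neg_distrib, Finset.sum_div]

theorem IsStdGaussianFamily.prod {Ω Ω' κ κ' : Type*} [MeasurableSpace Ω] [MeasurableSpace Ω']
    [Fintype κ] [Fintype κ'] {P : Measure Ω} {Q : Measure Ω'} [SFinite P] [SFinite Q]
    {ξ : κ → Ω → ℝ} {η : κ' → Ω' → ℝ}
    (hξ : IsStdGaussianFamily P ξ) (hη : IsStdGaussianFamily Q η) :
    IsStdGaussianFamily (P.prod Q)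
      (Sum.elim (fun k ω => ξ k ω.1) (fun k ω => η k ω.2) : κ ⊕ κ' → Ω × Ω' → ℝ) := by
  refine ⟨?_, fun c => ?_⟩
  · rintro (k | k)
    · exact (hξ.1 k).comp measurable_fst
    · exact (hη.1 k).comp measurable_snd
  simp only [Fintype.sum_sum_type, Sum.elim_inl, Sum.elim_inr, Complex.ofReal_add, add_mul,
    Complex.exp_add]
  rw [integral_prod_mul
    (fun ω => Complex.exp (((∑ k, c (Sum.inl k) * ξ k ω : ℝ) : ℂ) * Complex.I))
    (fun ω => Complex.exp (((∑ k, c (Sum.inr k) * η k ω : ℝ) : ℂ) * Complex.I)), hξ.2, hη.2,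
    ← Complex.exp_add]
  congr 1
  ring

/-- Linear images of standard Gaussian families are multivariate Gaussian. -/
theorem IsStdGaussianFamily.map_eq {Ω κ ι : Type*} [MeasurableSpace Ω] [Fintype κ] [Fintype ι]
    [DecidableEq ι] {P : Measure Ω} [IsProbabilityMeasure P] {ξ : κ → Ω → ℝ}
    (hξ : IsStdGaussianFamily P ξ) (α : Matrix ι κ ℝ) :
    P.map (fun ω => WithLp.toLp 2 (fun p => ∑ k, α p k * ξ k ω)) =
      multivariateGaussian 0 (α * αᵀ) := by
  have hm : Measurable (fun ω => WithLp.toLp 2 (fun p => ∑ k, α p k * ξ k ω)) := by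
    have := hξ.1
    fun_prop
  have : IsProbabilityMeasure
      (P.map (fun ω => WithLp.toLp 2 (fun p => ∑ k, α p k * ξ k ω))) :=
    Measure.isProbabilityMeasure_map hm.aemeasurable
  have hpsd : (α * αᵀ).PosSemidef := by
    simpa using Matrix.posSemidef_self_mul_conjTranspose α
  apply Measure.ext_of_charFun
  ext x
  rw [charFun_multivariateGaussian hpsd, charFun_apply, integral_map hm.aemeasurable
    (Measurable.aestronglyMeasurable (by fun_prop))]
  have hquad : x.ofLp ⬝ᵥ (α * αᵀ) *ᵥ x.ofLp = ∑ k, (∑ p, x p * α p k) ^ 2 := by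
    rw [← Matrix.mulVec_mulVec, Matrix.dotProduct_mulVec, Matrix.mulVec_transpose]
    simp [dotProduct, Matrix.vecMul, sq]
  have hlin : ∀ ω, inner ℝ (WithLp.toLp 2 (fun p => ∑ k, α p k * ξ k ω)) x =
      ∑ k, (∑ p, x p * α p k) * ξ k ω := fun ω => by
    simp only [PiLp.inner_apply, Finset.sum_mul, Finset.mul_sum, RCLike.inner_apply, conj_trivial]
    rw [Finset.sum_comm]
    simp [mul_assoc]
  simp_rw [hlin, hξ.2, hquad]
  congr 1
  simp [neg_div]

theorem multivariateGaussian_conv {ι : Type*} [Fintype ι] [DecidableEq ι] {A B : Matrix ι ι ℝ}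
    (hA : A.PosSemidef) (hB : B.PosSemidef) :
    multivariateGaussian 0 A ∗ multivariateGaussian 0 B = multivariateGaussian 0 (A + B) := by
  apply Measure.ext_of_charFun
  ext x
  rw [charFun_conv, charFun_multivariateGaussian hA, charFun_multivariateGaussian hB,
    charFun_multivariateGaussian (hA.add hB), ← Complex.exp_add]
  congr 1
  simp only [inner_zero_right, Matrix.add_mulVec, dotProduct_add]
  push_cast
  ring

theorem multivariateGaussian_map_smul {ι : Type*} [Fintype ι] [DecidableEq ι] {A : Matrix ι ι ℝ}
    (hA : A.PosSemidef) (c : ℝ) :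
    (multivariateGaussian 0 A).map (fun y => c • y) = multivariateGaussian 0 (c ^ 2 • A) := by
  apply Measure.ext_of_charFun
  ext x
  rw [charFun_map_smul, charFun_multivariateGaussian hA,
    charFun_multivariateGaussian (hA.smul (sq_nonneg c))]
  congr 1
  simp [Matrix.mulVec_smul, Matrix.smul_mulVec]
  ring

/-- The event that some row of `y` lies strictly below the thresholds `l`. -/
def rowBelow {I J : Type*} (l : I × J → ℝ) : Set (EuclideanSpace ℝ (I × J)) :=
  {y | ∃ i, ∀ j, y (i, j) < l (i, j)}

theorem measurableSet_rowBelow {I J : Type*} [Finite I] [Finite J] (l : I × J → ℝ) :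
    MeasurableSet (rowBelow l) := by
  have := Fintype.ofFinite I
  have := Fintype.ofFinite J
  simp only [rowBelow, Set.ofPred_exists, Set.ofPred_forall]
  exact MeasurableSet.iUnion fun i => MeasurableSet.iInter fun j =>
    measurableSet_lt (by fun_prop) measurable_const

/-- The Gaussian law with covariance `A` gives every event `rowBelow l` at least the mass that
the Gaussian law with covariance `A'` does. -/
def GaussianRowDom {I J : Type*} [Fintype I] [Fintype J] [DecidableEq I] [DecidableEq J]
    (A A' : Matrix (I × J) (I × J) ℝ) : Prop :=
  ∀ l, multivariateGaussian 0 A' (rowBelow l) ≤ multivariateGaussian 0 A (rowBelow l)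

namespace GaussianRowDom

variable {I J : Type*} [Fintype I] [Fintype J] [DecidableEq I] [DecidableEq J]
  {A A' B B' : Matrix (I × J) (I × J) ℝ}

theorem rfl' : GaussianRowDom A A := fun _ => le_rfl

theorem trans (h : GaussianRowDom A A') (h' : GaussianRowDom A' B) : GaussianRowDom A B :=
  fun l => (h' l).trans (h l)

theorem add_left (hA : A.PosSemidef) (hA' : A'.PosSemidef) (hB : B.PosSemidef)
    (h : GaussianRowDom A A') : GaussianRowDom (B + A) (B + A') := by
  intro l
  rw [← multivariateGaussian_conv hB hA, ← multivariateGaussian_conv hB hA',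
    ← lintegral_indicator_one (measurableSet_rowBelow l),
    ← lintegral_indicator_one (measurableSet_rowBelow l),
    Measure.lintegral_conv (measurable_one.indicator (measurableSet_rowBelow l)),
    Measure.lintegral_conv (measurable_one.indicator (measurableSet_rowBelow l))]
  refine lintegral_mono fun x => ?_
  have hx : ∀ y, (rowBelow l).indicator (1 : EuclideanSpace ℝ (I × J) → ℝ≥0∞) (x + y) =
      (rowBelow fun p => l p - x p).indicator 1 y := fun y => by
    have : x + y ∈ rowBelow l ↔ y ∈ rowBelow fun p => l p - x p := by
      simp only [rowBelow, Set.mem_ofPred_eq, PiLp.add_apply, lt_sub_iff_add_lt']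
    by_cases hy : x + y ∈ rowBelow l
    · rw [Set.indicator_of_mem hy, Set.indicator_of_mem (this.1 hy), Pi.one_apply, Pi.one_apply]
    · rw [Set.indicator_of_notMem hy, Set.indicator_of_notMem (mt this.2 hy)]
  simp_rw [hx]
  rw [lintegral_indicator_one (measurableSet_rowBelow _),
    lintegral_indicator_one (measurableSet_rowBelow _)]
  exact h _

theorem add (hA : A.PosSemidef) (hA' : A'.PosSemidef) (hB : B.PosSemidef) (hB' : B'.PosSemidef)
    (h : GaussianRowDom A A') (h' : GaussianRowDom B B') : GaussianRowDom (A + B) (A' + B') := by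
  refine (h'.add_left hB hB' hA).trans ?_
  rw [add_comm A, add_comm A']
  exact h.add_left hA hA' hB'

theorem sum {σ : Type*} (s : Finset σ) (U V : σ → Matrix (I × J) (I × J) ℝ)
    (hU : ∀ k, (U k).PosSemidef) (hV : ∀ k, (V k).PosSemidef)
    (h : ∀ k, GaussianRowDom (U k) (V k)) : GaussianRowDom (∑ k ∈ s, U k) (∑ k ∈ s, V k) := by
  classical
  induction s using Finset.induction_on with
  | empty => simpa using rfl'
  | insert a s ha ih =>
    rw [Finset.sum_insert ha, Finset.sum_insert ha]
    exact add (hU a) (hV a) (Matrix.posSemidef_sum s fun k _ => hU k)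
      (Matrix.posSemidef_sum s fun k _ => hV k) (h a) ih

end GaussianRowDom

/-- A diagonal section of a decreasing set that is a union of events depending on a single
coordinate has at most the mass of the set under the product measure. -/
theorem measure_diag_le_prod (γ : Measure ℝ) [IsProbabilityMeasure γ] (S : Set (ℝ × ℝ))
    (hS : MeasurableSet S)
    (hanti : ∀ a b a' b', a' ≤ a → b' ≤ b → (a, b) ∈ S → (a', b') ∈ S)
    (hsplit : ∀ a b, (a, a) ∈ S → (a, b) ∈ S ∨ (b, a) ∈ S) :
    γ {a | (a, a) ∈ S} ≤ γ.prod γ S := by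
  set D : Set ℝ := {a | (a, a) ∈ S}
  have hD : MeasurableSet D := hS.preimage (by fun_prop : Measurable fun a : ℝ => (a, a))
  have h1 : γ.prod γ (Prod.fst ⁻¹' D) = γ D :=
    measurePreserving_fst.measure_preimage hD.nullMeasurableSet
  have h2 : γ.prod γ (Prod.snd ⁻¹' D) = γ D :=
    measurePreserving_snd.measure_preimage hD.nullMeasurableSet
  have h3 : γ.prod γ (Prod.swap ⁻¹' S) = γ.prod γ S :=
    Measure.measurePreserving_swap.measure_preimage hS.nullMeasurableSet
  have hunion : Prod.fst ⁻¹' D ∪ Prod.snd ⁻¹' D ⊆ S ∪ Prod.swap ⁻¹' S := by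
    rintro ⟨a, b⟩ (h | h)
    · exact hsplit a b h
    · exact (hsplit b a h).symm
  have hinter : Prod.fst ⁻¹' D ∩ Prod.snd ⁻¹' D ⊆ S ∩ Prod.swap ⁻¹' S := by
    rintro ⟨a, b⟩ ⟨ha, hb⟩
    rcases le_total a b with h | h
    · exact ⟨hanti b b a b h le_rfl hb, hanti b b b a le_rfl h hb⟩
    · exact ⟨hanti a a a b le_rfl h ha, hanti a a b a h le_rfl ha⟩
  have h4 : γ D + γ D ≤ γ.prod γ S + γ.prod γ S := by
    calc γ D + γ D = γ.prod γ (Prod.fst ⁻¹' D) + γ.prod γ (Prod.snd ⁻¹' D) := by rw [h1, h2]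
      _ = γ.prod γ (Prod.fst ⁻¹' D ∪ Prod.snd ⁻¹' D) +
          γ.prod γ (Prod.fst ⁻¹' D ∩ Prod.snd ⁻¹' D) :=
        (measure_union_add_inter _ (measurable_snd hD)).symm
      _ ≤ γ.prod γ (S ∪ Prod.swap ⁻¹' S) + γ.prod γ (S ∩ Prod.swap ⁻¹' S) :=
        add_le_add (measure_mono hunion) (measure_mono hinter)
      _ = γ.prod γ S + γ.prod γ (Prod.swap ⁻¹' S) :=
        measure_union_add_inter _ (measurable_swap hS)
      _ = _ := by rw [h3]
  rw [← two_mul, ← two_mul] at h4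
  exact (ENNReal.mul_le_mul_iff_right (by simp) (by simp)).1 h4

theorem isStdGaussianFamily_real :
    IsStdGaussianFamily (gaussianReal 0 1) (fun (_ : Unit) x => x) := by
  refine ⟨fun _ => measurable_id, fun c => ?_⟩
  simpa [← charFun_apply_real, neg_div] using charFun_gaussianReal (μ := 0) (v := 1) (c ())

theorem Matrix.posSemidef_vecMulVec_self {ι : Type*} [Fintype ι] (v : ι → ℝ) :
    (Matrix.vecMulVec v v).PosSemidef := by
  simpa using Matrix.posSemidef_vecMulVec_self_star v

namespace GaussianRowDom

variable {I J : Type*} [Fintype I] [Fintype J] [DecidableEq I] [DecidableEq J]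

/-- Correlating the noise of two entries in distinct rows. -/
theorem pair {c : ℝ} (hc : 0 ≤ c) {p q : I × J} (hpq : p.1 ≠ q.1) :
    GaussianRowDom
      (c • (Matrix.vecMulVec (Pi.single p 1) (Pi.single p 1) +
        Matrix.vecMulVec (Pi.single q 1) (Pi.single q 1)))
      (c • Matrix.vecMulVec (Pi.single p 1 + Pi.single q 1) (Pi.single p 1 + Pi.single q 1)) := by
  intro l
  let e : I × J → I × J → ℝ := fun p => Pi.single p 1
  let α : Matrix (I × J) (Unit ⊕ Unit) ℝ :=
    Matrix.of fun r k => √c * Sum.elim (fun _ => e p r) (fun _ => e q r) k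
  let β : Matrix (I × J) Unit ℝ := Matrix.of fun r _ => √c * (e p r + e q r)
  have hα : c • (Matrix.vecMulVec (Pi.single p 1) (Pi.single p 1) +
      Matrix.vecMulVec (Pi.single q 1) (Pi.single q 1)) = α * αᵀ := by
    ext r s
    simp only [Matrix.smul_apply, Matrix.add_apply, Matrix.vecMulVec_apply, Matrix.mul_apply,
      Fintype.sum_sum_type, α, e, Matrix.transpose_apply, Matrix.of_apply, Sum.elim_inl,
      Sum.elim_inr, Finset.univ_unique, Finset.sum_singleton, smul_eq_mul]
    linear_combination (-(e p r * e p s + e q r * e q s)) * Real.mul_self_sqrt hc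
  have hβ : c • Matrix.vecMulVec (Pi.single p 1 + Pi.single q 1)
      (Pi.single p 1 + Pi.single q 1) = β * βᵀ := by
    ext r s
    simp only [Matrix.smul_apply, Matrix.vecMulVec_apply, Matrix.mul_apply,
      β, e, Matrix.transpose_apply, Matrix.of_apply, Pi.add_apply,
      Finset.univ_unique, Finset.sum_singleton, smul_eq_mul]
    linear_combination (-((e p r + e q r) * (e p s + e q s))) * Real.mul_self_sqrt hc
  rw [hα, hβ, ← (isStdGaussianFamily_real.prod isStdGaussianFamily_real).map_eq α,
    ← isStdGaussianFamily_real.map_eq β,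
    Measure.map_apply (by fun_prop) (measurableSet_rowBelow l),
    Measure.map_apply ?_ (measurableSet_rowBelow l)]
  swap
  · have := (isStdGaussianFamily_real.prod isStdGaussianFamily_real).1
    fun_prop
  have hα' : ∀ ω : ℝ × ℝ, ∀ r, ∑ k, α r k * (Sum.elim (fun _ ω => ω.1) (fun _ ω => ω.2) :
      Unit ⊕ Unit → ℝ × ℝ → ℝ) k ω = √c * (e p r * ω.1 + e q r * ω.2) := fun ω r => by
    simp [α]; ring
  have hβ' : ∀ ω : ℝ, ∀ r, ∑ k, β r k * ω = √c * (e p r * ω + e q r * ω) := fun ω r => by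
    simp [β]; ring
  simp only [hα', hβ', Set.preimage, rowBelow, Set.mem_ofPred_eq]
  have he : ∀ p r, 0 ≤ e p r := fun p r => by
    simp only [e, Pi.single_apply]; split_ifs <;> simp
  have he0 : ∀ {p r : I × J}, r.1 ≠ p.1 → e p r = 0 := fun {p r} h => by
    simp only [e, Pi.single_apply]
    rw [if_neg]
    rintro rfl
    exact h rfl
  refine measure_diag_le_prod (gaussianReal 0 1)
    {ω | ∃ i, ∀ j, √c * (e p (i, j) * ω.1 + e q (i, j) * ω.2) < l (i, j)} ?_ ?_ ?_
  · simp only [Set.ofPred_exists, Set.ofPred_forall]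
    exact MeasurableSet.iUnion fun i => MeasurableSet.iInter fun j =>
      measurableSet_lt (by fun_prop) measurable_const
  · rintro a b a' b' ha hb ⟨i, hi⟩
    refine ⟨i, fun j => lt_of_le_of_lt ?_ (hi j)⟩
    have := he p (i, j)
    have := he q (i, j)
    dsimp only
    gcongr
  · rintro a b ⟨i, hi⟩
    by_cases h : i = p.1
    · refine Or.inl ⟨i, fun j => ?_⟩
      have := hi j
      have h0 : e q (i, j) = 0 := he0 (by simpa [h] using hpq)
      simpa [h0] using this
    · refine Or.inr ⟨i, fun j => ?_⟩
      have := hi j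
      have h0 : e p (i, j) = 0 := he0 (by simpa using h)
      simpa [h0] using this

/-- Uncorrelated noise attached to a matrix of weights on pairs of entries. -/
def uncorrelated (D : Matrix (I × J) (I × J) ℝ) : Matrix (I × J) (I × J) ℝ :=
  ∑ k : (I × J) × (I × J), D k.1 k.2 • (Matrix.vecMulVec (Pi.single k.1 1) (Pi.single k.1 1) +
    Matrix.vecMulVec (Pi.single k.2 1) (Pi.single k.2 1))

theorem posSemidef_uncorrelated {D : Matrix (I × J) (I × J) ℝ} (hD : ∀ p q, 0 ≤ D p q) :
    (uncorrelated D).PosSemidef :=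
  Matrix.posSemidef_sum _ fun _ _ => ((Matrix.posSemidef_vecMulVec_self _).add
    (Matrix.posSemidef_vecMulVec_self _)).smul (hD _ _)

theorem uncorrelated_add {D : Matrix (I × J) (I × J) ℝ} (hsymm : ∀ p q, D p q = D q p)
    (hD : ∀ p q, 0 ≤ D p q) (hrow : ∀ p q, p.1 = q.1 → D p q = 0) :
    (uncorrelated D + (2 : ℝ) • D).PosSemidef ∧
      GaussianRowDom (uncorrelated D) (uncorrelated D + (2 : ℝ) • D) := by
  have h : uncorrelated D + (2 : ℝ) • D = ∑ k : (I × J) × (I × J),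
      D k.1 k.2 • Matrix.vecMulVec (Pi.single k.1 1 + Pi.single k.2 1)
        (Pi.single k.1 1 + Pi.single k.2 1) := by
    have hk : ∀ k : (I × J) × (I × J),
        D k.1 k.2 • Matrix.vecMulVec (Pi.single k.1 1 + Pi.single k.2 1)
          (Pi.single k.1 1 + Pi.single k.2 (1 : ℝ)) =
        D k.1 k.2 • (Matrix.vecMulVec (Pi.single k.1 1) (Pi.single k.1 1) +
          Matrix.vecMulVec (Pi.single k.2 1) (Pi.single k.2 1)) +
        (Matrix.single k.1 k.2 (D k.1 k.2) + Matrix.single k.2 k.1 (D k.2 k.1)) := fun k => by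
      rw [hsymm k.2 k.1]
      have hs : ∀ p q : I × J, Matrix.single p q (D k.1 k.2) =
          D k.1 k.2 • Matrix.vecMulVec (Pi.single p 1) (Pi.single q (1 : ℝ)) := fun p q => by
        rw [← Matrix.single_eq_single_vecMulVec_single, Matrix.smul_single, smul_eq_mul, mul_one]
      rw [hs, hs]
      simp only [Matrix.vecMulVec_add, Matrix.add_vecMulVec, smul_add]
      abel
    have hsum : ∑ k : (I × J) × (I × J), Matrix.single k.1 k.2 (D k.1 k.2) = D := by
      rw [Fintype.sum_prod_type]
      exact (Matrix.matrix_eq_sum_single D).symm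
    have hsum' : ∑ k : (I × J) × (I × J), Matrix.single k.2 k.1 (D k.2 k.1) = D := by
      rw [Fintype.sum_prod_type_right]
      exact (Matrix.matrix_eq_sum_single D).symm
    rw [Finset.sum_congr rfl fun k _ => hk k, Finset.sum_add_distrib, Finset.sum_add_distrib,
      hsum, hsum', two_smul]
    rfl
  rw [h]
  refine ⟨Matrix.posSemidef_sum _ fun k _ =>
    (Matrix.posSemidef_vecMulVec_self _).smul (hD _ _), ?_⟩
  refine sum _ _ _ (fun k => ((Matrix.posSemidef_vecMulVec_self _).add
    (Matrix.posSemidef_vecMulVec_self _)).smul (hD _ _))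
    (fun k => (Matrix.posSemidef_vecMulVec_self _).smul (hD _ _)) fun k => ?_
  by_cases hkk : k.1.1 = k.2.1
  · simpa [hrow _ _ hkk] using rfl'
  · exact pair (hD _ _) hkk

theorem add_uncorrelated {A A' : Matrix (I × J) (I × J) ℝ} (hA : A.PosSemidef)
    (hA' : A'.PosSemidef) (hle : ∀ p q, A p q ≤ A' p q)
    (hrow : ∀ p q, p.1 = q.1 → A p q = A' p q) (N : ℕ) :
    GaussianRowDom (A + (2 * ((N : ℝ) + 1))⁻¹ • uncorrelated (A' - A))
      (A' + (2 * ((N : ℝ) + 1))⁻¹ • uncorrelated (A' - A)) := by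
  set D := A' - A with hDdef
  set δ : ℝ := (2 * ((N : ℝ) + 1))⁻¹ with hδ
  have hδ0 : 0 ≤ δ := by positivity
  have hsymm : ∀ p q, D p q = D q p := fun p q => by
    have := (hA'.isHermitian.sub hA.isHermitian).apply p q
    simpa [D] using this.symm
  have hD : ∀ p q, 0 ≤ D p q := fun p q => sub_nonneg.2 (hle p q)
  have hDrow : ∀ p q, p.1 = q.1 → D p q = 0 := fun p q h => sub_eq_zero.2 (hrow p q h).symm
  obtain ⟨hV, hstep⟩ : (δ • uncorrelated D + (2 * δ) • D).PosSemidef ∧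
      GaussianRowDom (δ • uncorrelated D) (δ • uncorrelated D + (2 * δ) • D) := by
    have h := uncorrelated_add (D := δ • D) (fun p q => by simp [hsymm p q])
      (fun p q => mul_nonneg hδ0 (hD p q)) (fun p q h => by simp [hDrow p q h])
    have hu : uncorrelated (δ • D) = δ • uncorrelated D := by
      simp [uncorrelated, Finset.smul_sum, mul_smul]
    rwa [hu, smul_smul] at h
  have key : ∀ k : ℕ, k ≤ N + 1 →
      GaussianRowDom (A + δ • uncorrelated D) (A + (k * (2 * δ)) • D + δ • uncorrelated D) := by
    intro k
    induction k with
    | zero => intro _; simpa using rfl'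
    | succ k ih =>
      intro hk
      refine (ih (by omega)).trans ?_
      set s : ℝ := k * (2 * δ)
      have hs0 : 0 ≤ s := by positivity
      have hs1 : s ≤ 1 := by
        have : (k : ℝ) ≤ N + 1 := by exact_mod_cast (by omega : k ≤ N + 1)
        have h2 : 2 * δ = ((N : ℝ) + 1)⁻¹ := by rw [hδ, mul_inv]; ring
        simp only [s]
        rw [h2, ← div_eq_mul_inv]
        exact (div_le_one (by positivity)).2 this
      have hM : (A + s • D).PosSemidef := by
        have : A + s • D = (1 - s) • A + s • A' := by
          simp only [D, smul_sub, sub_smul, one_smul]; abel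
        rw [this]
        exact (hA.smul (sub_nonneg.2 hs1)).add (hA'.smul hs0)
      have := hstep.add_left ((posSemidef_uncorrelated hD).smul hδ0) hV hM
      convert this using 1
      push_cast
      rw [add_mul, one_mul, add_smul]
      abel
  have h := key (N + 1) le_rfl
  have h1 : ((N + 1 : ℕ) : ℝ) * (2 * δ) = 1 := by
    rw [hδ]; push_cast; field_simp
  rw [h1, one_smul] at h
  simpa [D] using h

end GaussianRowDom

/-- If inequalities `P (s k) ≤ Q (s' k)` hold along two sequences of events, then the mass of the
lower limit of `s` is at most that of the upper limit of `s'`. -/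
theorem measure_le_of_liminf_limsup {Ω Ω' : Type*} [MeasurableSpace Ω] [MeasurableSpace Ω']
    {P : Measure Ω} {Q : Measure Ω'} [IsFiniteMeasure Q] {s : ℕ → Set Ω} {s' : ℕ → Set Ω'}
    (hs' : ∀ k, MeasurableSet (s' k)) (h : ∀ k, P (s k) ≤ Q (s' k)) {S : Set Ω} {S' : Set Ω'}
    (hS : ∀ ω ∈ S, ∀ᶠ k in Filter.atTop, ω ∈ s k)
    (hS' : ∀ ω, (∃ᶠ k in Filter.atTop, ω ∈ s' k) → ω ∈ S') : P S ≤ Q S' := by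
  have h1 : S ⊆ ⋃ n : ℕ, ⋂ k ≥ n, s k := fun ω hω => by
    simpa [Filter.eventually_atTop] using hS ω hω
  have h2 : ⋂ n : ℕ, ⋃ k ≥ n, s' k ⊆ S' := fun ω hω => by
    refine hS' ω (Filter.frequently_atTop.2 fun n => ?_)
    have := Set.mem_iInter.1 hω n
    simpa using this
  have hanti : Antitone fun n : ℕ => ⋃ k ≥ n, s' k := fun n m hnm =>
    Set.biUnion_mono (fun k hk => le_trans hnm hk) fun _ _ => le_rfl
  have hmono : Monotone fun n : ℕ => ⋂ k ≥ n, s k := fun n m hnm =>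
    Set.biInter_mono (fun k hk => le_trans hnm hk) fun _ _ => le_rfl
  have hlim : Filter.Tendsto (fun n : ℕ => Q (⋃ k ≥ n, s' k)) Filter.atTop
      (nhds (Q (⋂ n : ℕ, ⋃ k ≥ n, s' k))) :=
    tendsto_measure_iInter_atTop (fun n => (MeasurableSet.iUnion fun k =>
      MeasurableSet.iUnion fun _ => hs' k).nullMeasurableSet) hanti ⟨0, measure_ne_top _ _⟩
  refine (measure_mono h1).trans (le_trans ?_ (measure_mono h2))
  rw [hmono.measure_iUnion]
  refine iSup_le fun n => ge_of_tendsto hlim ?_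
  filter_upwards [Filter.eventually_ge_atTop n] with m hm
  calc P (⋂ k ≥ n, s k) ≤ P (s m) := measure_mono (Set.biInter_subset_of_mem hm)
    _ ≤ Q (s' m) := h m
    _ ≤ Q (⋃ k ≥ m, s' k) := measure_mono (Set.subset_biUnion_of_mem (u := s') (le_refl m))

/-- Gordon's comparison inequality for min-max events, for covariances that agree within
rows. -/
theorem multivariateGaussian_rowBelow_le {I J : Type*} [Fintype I] [Fintype J] [DecidableEq I]
    [DecidableEq J] {A A' : Matrix (I × J) (I × J) ℝ} (hA : A.PosSemidef)
    (hA' : A'.PosSemidef) (hle : ∀ p q, A p q ≤ A' p q)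
    (hrow : ∀ p q, p.1 = q.1 → A p q = A' p q) (l : I × J → ℝ) :
    multivariateGaussian 0 A' (rowBelow l) ≤
      multivariateGaussian 0 A {y | ∃ i, ∀ j, y (i, j) ≤ l (i, j)} := by
  set U := GaussianRowDom.uncorrelated (A' - A)
  have hU : U.PosSemidef :=
    GaussianRowDom.posSemidef_uncorrelated fun p q => sub_nonneg.2 (hle p q)
  let r : ℕ → ℝ := fun N => √((2 * ((N : ℝ) + 1))⁻¹)
  have hr : Filter.Tendsto r Filter.atTop (nhds 0) := by
    have h : Filter.Tendsto (fun N : ℕ => (2 * ((N : ℝ) + 1))⁻¹) Filter.atTop (nhds 0) := by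
      have := (tendsto_one_div_add_atTop_nhds_zero_nat (𝕜 := ℝ)).const_mul 2⁻¹
      simpa [mul_inv, mul_comm] using this
    have h' := (Real.continuous_sqrt.tendsto 0).comp h
    rwa [Real.sqrt_zero] at h'
  have hlaw : ∀ B : Matrix (I × J) (I × J) ℝ, B.PosSemidef → ∀ N : ℕ,
      multivariateGaussian 0 (B + (2 * ((N : ℝ) + 1))⁻¹ • U) =
        ((multivariateGaussian 0 B).prod (multivariateGaussian 0 U)).map
          (fun y => y.1 + r N • y.2) := fun B hB N => by
    have h : (2 * ((N : ℝ) + 1))⁻¹ = r N ^ 2 := (Real.sq_sqrt (by positivity)).symm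
    rw [h, ← multivariateGaussian_conv hB (hU.smul (sq_nonneg _)),
      ← multivariateGaussian_map_smul hU, Measure.conv]
    nth_rewrite 1 [← Measure.map_id (μ := multivariateGaussian 0 B)]
    rw [Measure.map_prod_map _ _ measurable_id (by fun_prop),
      Measure.map_map (by fun_prop) (by fun_prop)]
    rfl
  have hmain : ∀ N : ℕ, ((multivariateGaussian 0 A').prod (multivariateGaussian 0 U))
      ((fun y => y.1 + r N • y.2) ⁻¹' rowBelow l) ≤
      ((multivariateGaussian 0 A).prod (multivariateGaussian 0 U))
      ((fun y => y.1 + r N • y.2) ⁻¹' rowBelow l) := fun N => by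
    have := GaussianRowDom.add_uncorrelated hA hA' hle hrow N l
    rwa [hlaw A hA, hlaw A' hA', Measure.map_apply (by fun_prop) (measurableSet_rowBelow l),
      Measure.map_apply (by fun_prop) (measurableSet_rowBelow l)] at this
  have hlim : ∀ (y : EuclideanSpace ℝ (I × J) × EuclideanSpace ℝ (I × J)) p,
      Filter.Tendsto (fun N => (y.1 + r N • y.2) p) Filter.atTop (nhds (y.1 p)) := fun y p => by
    simpa using (hr.mul_const (y.2 p)).const_add (y.1 p)
  have h := measure_le_of_liminf_limsup
    (S := Prod.fst ⁻¹' rowBelow l) (S' := Prod.fst ⁻¹' {y | ∃ i, ∀ j, y (i, j) ≤ l (i, j)})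
    (fun N => (measurableSet_rowBelow l).preimage (by fun_prop)) hmain ?_ ?_
  · rwa [measurePreserving_fst.measure_preimage (measurableSet_rowBelow l).nullMeasurableSet,
      measurePreserving_fst.measure_preimage] at h
    refine MeasurableSet.nullMeasurableSet ?_
    simp only [Set.ofPred_exists, Set.ofPred_forall]
    exact MeasurableSet.iUnion fun i => MeasurableSet.iInter fun j =>
      measurableSet_le (by fun_prop) measurable_const
  · rintro y ⟨i, hi⟩
    have : ∀ᶠ N in Filter.atTop, ∀ j, (y.1 + r N • y.2) (i, j) < l (i, j) :=
      Filter.eventually_all.2 fun j => (hlim y (i, j)).eventually_lt_const (hi j)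
    filter_upwards [this] with N hN
    exact ⟨i, hN⟩
  · intro y hy
    by_contra hcon
    have hcon' : ∀ i, ∃ j, l (i, j) < y.1 (i, j) := by
      simpa [not_exists, not_forall] using hcon
    refine hy ?_
    choose j hj using hcon'
    have : ∀ᶠ N in Filter.atTop, ∀ i, l (i, j i) < (y.1 + r N • y.2) (i, j i) :=
      Filter.eventually_all.2 fun i => (hlim y (i, j i)).eventually_const_lt (hj i)
    filter_upwards [this] with N hN
    rintro ⟨i, hi⟩
    exact lt_asymm (hN i) (hi (j i))

/-- Gordon's comparison inequality for linear images of standard Gaussian families. -/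
theorem IsStdGaussianFamily.exists_forall_lt_le {Ω Ω' κ κ' I J : Type*} [MeasurableSpace Ω]
    [MeasurableSpace Ω'] [Fintype κ] [Fintype κ'] [Fintype I] [Fintype J] [DecidableEq I]
    [DecidableEq J] {P : Measure Ω} {Q : Measure Ω'} [IsProbabilityMeasure P]
    [IsProbabilityMeasure Q] {ξ : κ → Ω → ℝ} {η : κ' → Ω' → ℝ}
    (hξ : IsStdGaussianFamily P ξ) (hη : IsStdGaussianFamily Q η)
    (α : I → J → κ → ℝ) (β : I → J → κ' → ℝ)
    (hle : ∀ i j i' j', ∑ k, β i j k * β i' j' k ≤ ∑ k, α i j k * α i' j' k)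
    (hrow : ∀ i j j', ∑ k, β i j k * β i j' k = ∑ k, α i j k * α i j' k) (l : I → J → ℝ) :
    P {ω | ∃ i, ∀ j, ∑ k, α i j k * ξ k ω < l i j} ≤
      Q {ω | ∃ i, ∀ j, ∑ k, β i j k * η k ω ≤ l i j} := by
  let α' : Matrix (I × J) κ ℝ := Matrix.of fun p k => α p.1 p.2 k
  let β' : Matrix (I × J) κ' ℝ := Matrix.of fun p k => β p.1 p.2 k
  have h := multivariateGaussian_rowBelow_le (A := β' * β'ᵀ) (A' := α' * α'ᵀ)
    (by simpa using Matrix.posSemidef_self_mul_conjTranspose β')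
    (by simpa using Matrix.posSemidef_self_mul_conjTranspose α')
    (fun p q => by
      simpa [Matrix.mul_apply, α', β'] using hle p.1 p.2 q.1 q.2)
    (fun p q hpq => by
      simpa [Matrix.mul_apply, α', β', hpq] using hrow q.1 p.2 q.2) (fun p => l p.1 p.2)
  have hm : MeasurableSet
      {y : EuclideanSpace ℝ (I × J) | ∃ i, ∀ j, y (i, j) ≤ l i j} := by
    simp only [Set.ofPred_exists, Set.ofPred_forall]
    exact MeasurableSet.iUnion fun i => MeasurableSet.iInter fun j =>
      measurableSet_le (by fun_prop) measurable_const
  rw [← hξ.map_eq, ← hη.map_eq, Measure.map_apply ?_ (measurableSet_rowBelow _),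
    Measure.map_apply ?_ hm] at h
  · exact h
  · have := hη.1
    fun_prop
  · have := hξ.1
    fun_prop

theorem dotp_self {k : ℕ} (a : Fin k → ℝ) : dotp a a = nrm a ^ 2 := by
  rw [nrm, Real.sq_sqrt (Finset.sum_nonneg fun i _ => sq_nonneg _), dotp]
  exact Finset.sum_congr rfl fun i _ => (sq _).symm

theorem nrm_nonneg {k : ℕ} (a : Fin k → ℝ) : 0 ≤ nrm a := Real.sqrt_nonneg _

theorem dotp_comm {k : ℕ} (a b : Fin k → ℝ) : dotp a b = dotp b a :=
  Finset.sum_congr rfl fun _ _ => mul_comm _ _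

theorem abs_dotp_le {k : ℕ} (a b : Fin k → ℝ) : |dotp a b| ≤ nrm a * nrm b := by
  refine abs_le_of_sq_le_sq ?_ (mul_nonneg (nrm_nonneg a) (nrm_nonneg b))
  rw [mul_pow, ← dotp_self, ← dotp_self]
  simpa [dotp, sq] using Finset.sum_mul_sq_le_sq_mul_sq Finset.univ a b

/-- The covariance comparison between the two processes: `a`, `z` stand for `x − r Z(x)` and
`Z(x)`. -/
theorem covariance_comparison {m n : ℕ} {θ : ℝ} (hθ : θ ^ 2 ≤ 1) (a z a' z' : Fin n → ℝ)
    (u u' : Fin m → ℝ) (γ γ' : ℝ) (hz : nrm z = nrm z')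
    (h : dotp z a' ≤ θ * (nrm a' * nrm z')) (h' : dotp z' a ≤ θ * (nrm a * nrm z)) :
    dotp u u' * ((nrm a + γ * nrm z * θ) * (nrm a' + γ' * nrm z' * θ) +
        γ * nrm z * √(1 - θ ^ 2) * (γ' * nrm z' * √(1 - θ ^ 2))) +
      nrm u * nrm u' * (dotp a a' + |γ| * dotp z a' + |γ'| * dotp z' a + |γ| * |γ'| * dotp z z') ≤
    dotp u u' * (dotp a a' + γ * dotp z a' + γ' * dotp z' a + γ * γ' * dotp z z') +
      nrm u * nrm u' * ((nrm a + |γ| * nrm z * θ) * (nrm a' + |γ'| * nrm z' * θ) +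
        |γ| * nrm z * √(1 - θ ^ 2) * (|γ'| * nrm z' * √(1 - θ ^ 2))) := by
  have hν := Real.mul_self_sqrt (sub_nonneg.2 hθ)
  have hu : ∀ s, dotp u u' * s ≤ nrm u * nrm u' * |s| := fun s =>
    (le_abs_self _).trans (by rw [abs_mul]; gcongr; exact abs_dotp_le u u')
  have d1 : 0 ≤ nrm a * nrm a' - dotp a a' :=
    sub_nonneg.2 ((le_abs_self _).trans (abs_dotp_le a a'))
  have d4 : 0 ≤ nrm z * nrm z' - dotp z z' :=
    sub_nonneg.2 ((le_abs_self _).trans (abs_dotp_le z z'))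
  have e1 := mul_nonneg (sub_nonneg.2 (hu 1)) d1
  have e2 := mul_nonneg (sub_nonneg.2 (hu γ)) (sub_nonneg.2 h)
  have e3 := mul_nonneg (sub_nonneg.2 (hu γ')) (sub_nonneg.2 h')
  have e4 := mul_nonneg (sub_nonneg.2 (hu (γ * γ'))) d4
  rw [abs_mul] at e4
  rw [abs_one] at e1
  rw [hz] at e3 e4 ⊢
  have key := add_nonneg (add_nonneg (add_nonneg e1 e2) e3) e4
  rw [← sub_nonneg]
  refine key.trans_eq ?_
  linear_combination (-(nrm u * nrm u' * |γ| * |γ'| - dotp u u' * γ * γ') * nrm z' ^ 2) * hν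

theorem covariance_row_eq {m n : ℕ} {θ : ℝ} (hθ : θ ^ 2 ≤ 1) (a z : Fin n → ℝ)
    (u u' : Fin m → ℝ) (γ γ' : ℝ) (h : dotp z a = θ * (nrm a * nrm z)) :
    dotp u u' * ((nrm a + γ * nrm z * θ) * (nrm a + γ' * nrm z * θ) +
        γ * nrm z * √(1 - θ ^ 2) * (γ' * nrm z * √(1 - θ ^ 2))) +
      nrm u * nrm u' * (dotp a a + |γ| * dotp z a + |γ'| * dotp z a + |γ| * |γ'| * dotp z z) =
    dotp u u' * (dotp a a + γ * dotp z a + γ' * dotp z a + γ * γ' * dotp z z) +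
      nrm u * nrm u' * ((nrm a + |γ| * nrm z * θ) * (nrm a + |γ'| * nrm z * θ) +
        |γ| * nrm z * √(1 - θ ^ 2) * (|γ'| * nrm z * √(1 - θ ^ 2))) := by
  have hν := Real.mul_self_sqrt (sub_nonneg.2 hθ)
  rw [h, dotp_self, dotp_self]
  linear_combination (-(nrm u * nrm u' * |γ| * |γ'| - dotp u u' * γ * γ') * nrm z ^ 2) * hν

theorem sign_mul_xr {n : ℕ} {L r : ℝ} {x : Fin n → ℝ} {i : Fin n} (hx : x i ≠ 0)
    (hx' : x i ∉ Set.Ioo (-(L * r)) (L * r)) :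
    Real.sign (x i) * xr L r x i = |xr L r x i| := by
  rw [Set.mem_Ioo, not_and, not_lt] at hx'
  rcases lt_or_gt_of_ne hx with h | h
  · rw [xr, Real.sign_of_neg h, abs_of_nonpos]
    · ring
    · by_contra! hcon
      nlinarith [hx' (by linarith)]
  · rw [xr, Real.sign_of_pos h, abs_of_nonneg]
    · ring
    · by_contra! hcon
      nlinarith [hx' (by linarith)]

theorem nrm_Zv {n : ℕ} (L : ℝ) {x : Fin n → ℝ} (hx : ∀ i, x i ≠ 0) :
    nrm (Zv L x) = √(n * L ^ 2) := by
  have : ∀ i, Zv L x i ^ 2 = L ^ 2 := fun i => by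
    rcases Real.sign_apply_eq_of_ne_zero _ (hx i) with h | h <;> simp [Zv, h]
  simp [nrm, this]

theorem abs_sign_le_one (t : ℝ) : |Real.sign t| ≤ 1 := by
  rcases Real.sign_apply_eq t with h | h | h <;> simp [h]

theorem dotp_Zv_le {n : ℕ} {L r : ℝ} (hL : 0 < L) (x : Fin n → ℝ) {y : Fin n → ℝ}
    (hy : ∀ i, y i ≠ 0) (hy' : ∀ i, y i ∉ Set.Ioo (-(L * r)) (L * r)) :
    dotp (Zv L x) (xr L r y) ≤ dotp (Zv L y) (xr L r y) := by
  refine Finset.sum_le_sum fun i _ => ?_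
  simp only [Zv]
  rw [mul_assoc, mul_assoc, sign_mul_xr (hy i) (hy' i)]
  refine mul_le_mul_of_nonneg_left ((le_abs_self _).trans ?_) hL.le
  rw [abs_mul]
  exact mul_le_of_le_one_left (abs_nonneg _) (abs_sign_le_one _)

theorem nrm_xr_eq_zero {n : ℕ} {L r θ : ℝ} (hL : 0 < L) (hθ : θ < 0) {x : Fin n → ℝ}
    (hx : ∀ i, x i ≠ 0) (hx' : ∀ i, x i ∉ Set.Ioo (-(L * r)) (L * r))
    (h : dotp (xr L r x) (Zv L x) = θ * (nrm (xr L r x) * nrm (Zv L x))) :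
    nrm (xr L r x) = 0 := by
  have h1 : dotp (xr L r x) (Zv L x) = L * ∑ i, |xr L r x i| := by
    rw [dotp, Finset.mul_sum]
    refine Finset.sum_congr rfl fun i _ => ?_
    rw [← sign_mul_xr (hx i) (hx' i), Zv]
    ring
  have h2 : L * ∑ i, |xr L r x i| ≤ 0 := by
    rw [← h1, h]
    exact mul_nonpos_of_nonpos_of_nonneg hθ.le (mul_nonneg (nrm_nonneg _) (nrm_nonneg _))
  have h3 : ∑ i, |xr L r x i| = 0 :=
    le_antisymm (nonpos_of_mul_nonpos_right h2 hL) (Finset.sum_nonneg fun i _ => abs_nonneg _)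
  have h4 : ∀ i, xr L r x i = 0 := fun i =>
    abs_eq_zero.1 ((Finset.sum_eq_zero_iff_of_nonneg fun i _ => abs_nonneg _).1 h3 i
      (Finset.mem_univ i))
  simp [nrm, h4]

theorem half_le_gaussianReal_Iic : 2⁻¹ ≤ gaussianReal 0 1 (Set.Iic 0) ∧
    2⁻¹ ≤ gaussianReal 0 1 (Set.Ici 0) := by
  have h : gaussianReal 0 1 (Set.Iic 0) = gaussianReal 0 1 (Set.Ici 0) := by
    have := gaussianReal_map_neg (μ := 0) (v := 1)
    rw [neg_zero] at this
    rw [← this, Measure.map_apply measurable_neg measurableSet_Iic, this]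
    simp
  have h1 : 1 ≤ gaussianReal 0 1 (Set.Iic 0) + gaussianReal 0 1 (Set.Ici 0) := by
    rw [← measure_univ (μ := gaussianReal 0 1), ← Set.Iic_union_Ici (a := (0 : ℝ))]
    exact measure_union_le _ _
  have h2 : 2⁻¹ ≤ gaussianReal 0 1 (Set.Iic 0) := by
    rw [← h, ← two_mul] at h1
    rwa [ENNReal.inv_le_iff_le_mul (by simp) (by simp)]
  exact ⟨h2, h ▸ h2⟩

/-- Two independent standard Gaussian variables have prescribed signs with probability at least
`1 / 4`. -/
theorem quarter_le_stdVec (S : Set ℝ) (hS : S = Set.Iic 0 ∨ S = Set.Ici 0) :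
    4⁻¹ ≤ stdVec 2 {y | y 0 ∈ S ∧ y 1 ∈ Set.Iic 0} := by
  have h : {y : Fin 2 → ℝ | y 0 ∈ S ∧ y 1 ∈ Set.Iic 0} =
      Set.pi Set.univ ![S, Set.Iic 0] := by
    ext y
    simp [Set.mem_pi, Fin.forall_fin_two]
  have hS' : 2⁻¹ ≤ gaussianReal 0 1 S := by
    rcases hS with rfl | rfl
    exacts [half_le_gaussianReal_Iic.1, half_le_gaussianReal_Iic.2]
  rw [h, stdVec, Measure.pi_pi, Fin.prod_univ_two]
  calc (4⁻¹ : ℝ≥0∞) = 2⁻¹ * 2⁻¹ := by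
        rw [← ENNReal.mul_inv (by simp) (by simp)]; norm_num
    _ ≤ _ := mul_le_mul' hS' half_le_gaussianReal_Iic.1

instance (m n : ℕ) : IsProbabilityMeasure (stdMat m n) := by unfold stdMat; infer_instance

instance (k : ℕ) : IsProbabilityMeasure (stdVec k) := by unfold stdVec; infer_instance

theorem sum_mul_mul_eq_dotp {m n : ℕ} (u u' : Fin m → ℝ) (v v' : Fin n → ℝ) :
    ∑ k : Fin m × Fin n, u k.1 * v k.2 * (u' k.1 * v' k.2) = dotp u u' * dotp v v' := by
  rw [dotp, dotp, Finset.sum_mul_sum, Fintype.sum_prod_type]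
  exact Finset.sum_congr rfl fun _ _ => Finset.sum_congr rfl fun _ _ => by ring

theorem dotp_combo {n : ℕ} (a z a' z' : Fin n → ℝ) (s s' : ℝ) :
    dotp (fun k => a k + s * z k) (fun k => a' k + s' * z' k) =
      dotp a a' + s * dotp z a' + s' * dotp z' a + s * s' * dotp z z' := by
  simp only [dotp, Finset.mul_sum, ← Finset.sum_add_distrib]
  exact Finset.sum_congr rfl fun _ _ => by ring

theorem sum_smul_mul_smul {k : ℕ} (u u' : Fin k → ℝ) (c c' : ℝ) :
    ∑ i, u i * c * (u' i * c') = dotp u u' * (c * c') := by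
  rw [dotp, Finset.sum_mul]
  exact Finset.sum_congr rfl fun _ _ => by ring

theorem dotp_mulV_eq_sum {m n : ℕ} (u : Fin m → ℝ) (G : Fin m → Fin n → ℝ) (a z : Fin n → ℝ)
    (γ : ℝ) : dotp u (mulV G a) + γ * dotp u (mulV G z) =
      ∑ k : Fin m × Fin n, u k.1 * (a k.2 + γ * z k.2) * G k.1 k.2 := by
  rw [Fintype.sum_prod_type]
  simp only [dotp, mulV, Finset.mul_sum, ← Finset.sum_add_distrib]
  exact Finset.sum_congr rfl fun _ _ => Finset.sum_congr rfl fun _ _ => by ring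

theorem decoupled_eq_sum {m n : ℕ} (θ ν : ℝ) (u g f : Fin m → ℝ) (h a z : Fin n → ℝ) (γ : ℝ) :
    nrm a * dotp g u - nrm u * dotp h a + γ * nrm z * dotp (fun k => θ * g k + ν * f k) u -
        |γ| * nrm u * dotp h z =
      ∑ k, u k * (nrm a + γ * nrm z * θ) * g k + (∑ k, u k * (γ * nrm z * ν) * f k +
        ∑ k, -(a k + |γ| * z k) * nrm u * h k) := by
  have h1 : ∑ k, u k * (nrm a + γ * nrm z * θ) * g k + ∑ k, u k * (γ * nrm z * ν) * f k =
      nrm a * dotp g u + γ * nrm z * dotp (fun k => θ * g k + ν * f k) u := by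
    simp only [dotp, Finset.mul_sum, ← Finset.sum_add_distrib]
    exact Finset.sum_congr rfl fun _ _ => by ring
  have h2 : ∑ k, -(a k + |γ| * z k) * nrm u * h k =
      -(nrm u * dotp h a + |γ| * nrm u * dotp h z) := by
    simp only [dotp, Finset.mul_sum, ← Finset.sum_add_distrib, ← Finset.sum_neg_distrib]
    exact Finset.sum_congr rfl fun _ _ => by ring
  rw [← add_assoc, h1, h2]
  ring

/-- The comparison for finitely many index points; `a i`, `z i` stand for `x − r Z(x)`, `Z(x)`. -/
theorem measure_exists_forall_lt_le_four_mul {m n : ℕ} {I J : Type*} [Fintype I] [Fintype J]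
    [DecidableEq I] [DecidableEq J] {θ : ℝ} (hθ : θ ^ 2 ≤ 1) (a z : I → Fin n → ℝ)
    (u : J → Fin m → ℝ) (γ : J → ℝ) (hz : ∀ i i', nrm (z i) = nrm (z i'))
    (hza : ∀ i i', dotp (z i) (a i') ≤ θ * (nrm (a i') * nrm (z i')))
    (hza' : ∀ i, dotp (z i) (a i) = θ * (nrm (a i) * nrm (z i)))
    (hneg : θ < 0 → ∀ i, nrm (a i) = 0) (l : I → J → ℝ) :
    stdMat m n {G | ∃ i, ∀ j, dotp (u j) (mulV G (a i)) + γ j * dotp (u j) (mulV G (z i)) < l i j} ≤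
      4 * ((stdVec m).prod ((stdVec m).prod (stdVec n))) {ω | ∃ i, ∀ j,
        nrm (a i) * dotp ω.1 (u j) - nrm (u j) * dotp ω.2.2 (a i) +
          γ j * nrm (z i) * dotp (fun k => θ * ω.1 k + √(1 - θ ^ 2) * ω.2.1 k) (u j) -
          |γ j| * nrm (u j) * dotp ω.2.2 (z i) ≤ l i j} := by
  let α : I → J → (Fin m × Fin n) ⊕ Fin 2 → ℝ := fun i j =>
    Sum.elim (fun k => u j k.1 * (a i k.2 + γ j * z i k.2))
      ![nrm (u j) * (nrm (a i) + |γ j| * nrm (z i) * θ),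
        nrm (u j) * (|γ j| * nrm (z i) * √(1 - θ ^ 2))]
  let β : I → J → Fin m ⊕ (Fin m ⊕ Fin n) → ℝ := fun i j =>
    Sum.elim (fun k => u j k * (nrm (a i) + γ j * nrm (z i) * θ))
      (Sum.elim (fun k => u j k * (γ j * nrm (z i) * √(1 - θ ^ 2)))
        (fun k => -(a i k + |γ j| * z i k) * nrm (u j)))
  have hα : ∀ i j i' j', ∑ k, α i j k * α i' j' k = dotp (u j) (u j') *
      (dotp (a i) (a i') + γ j * dotp (z i) (a i') + γ j' * dotp (z i') (a i) +
        γ j * γ j' * dotp (z i) (z i')) + nrm (u j) * nrm (u j') *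
      ((nrm (a i) + |γ j| * nrm (z i) * θ) * (nrm (a i') + |γ j'| * nrm (z i') * θ) +
        |γ j| * nrm (z i) * √(1 - θ ^ 2) * (|γ j'| * nrm (z i') * √(1 - θ ^ 2))) := by
    intro i j i' j'
    have := sum_mul_mul_eq_dotp (u j) (u j') (fun k => a i k + γ j * z i k)
      (fun k => a i' k + γ j' * z i' k)
    simp only [α, Fintype.sum_sum_type, Sum.elim_inl, Sum.elim_inr, Fin.sum_univ_two,
      Matrix.cons_val_zero, Matrix.cons_val_one, this, dotp_combo]
    ring
  have hβ : ∀ i j i' j', ∑ k, β i j k * β i' j' k = dotp (u j) (u j') *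
      ((nrm (a i) + γ j * nrm (z i) * θ) * (nrm (a i') + γ j' * nrm (z i') * θ) +
        γ j * nrm (z i) * √(1 - θ ^ 2) * (γ j' * nrm (z i') * √(1 - θ ^ 2))) +
      nrm (u j) * nrm (u j') * (dotp (a i) (a i') + |γ j| * dotp (z i) (a i') +
        |γ j'| * dotp (z i') (a i) + |γ j| * |γ j'| * dotp (z i) (z i')) := by
    intro i j i' j'
    have := sum_smul_mul_smul (fun k => a i k + |γ j| * z i k)
      (fun k => a i' k + |γ j'| * z i' k) (nrm (u j)) (nrm (u j'))
    simp only [β, Fintype.sum_sum_type, Sum.elim_inl, Sum.elim_inr, sum_smul_mul_smul, neg_mul,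
      mul_neg, neg_neg, this, dotp_combo]
    ring
  have gordon := ((show IsStdGaussianFamily (stdMat m n) (fun (k : Fin m × Fin n) G => G k.1 k.2) from
    isStdGaussianFamily_stdMat m n).prod (show IsStdGaussianFamily (stdVec 2) (fun k y => y k) from
    isStdGaussianFamily_pi)).exists_forall_lt_le
    ((show IsStdGaussianFamily (stdVec m) (fun k y => y k) from isStdGaussianFamily_pi).prod
      ((show IsStdGaussianFamily (stdVec m) (fun k y => y k) from isStdGaussianFamily_pi).prod
        (show IsStdGaussianFamily (stdVec n) (fun k y => y k) from isStdGaussianFamily_pi)))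
    α β
    (fun i j i' j' => by
      rw [hα, hβ]
      exact covariance_comparison hθ _ _ _ _ _ _ _ _ (hz i i') (hza i i') (hza i' i))
    (fun i j j' => by
      rw [hα, hβ]
      exact covariance_row_eq hθ _ _ _ _ _ _ (hza' i)) l
  set S : Set ℝ := if 0 ≤ θ then Set.Iic 0 else Set.Ici 0 with hS
  have hquarter := quarter_le_stdVec S (by by_cases h : 0 ≤ θ <;> simp [hS, h])
  set N : Set (Fin 2 → ℝ) := {y | y 0 ∈ S ∧ y 1 ∈ Set.Iic 0}
  have hN : ∀ y ∈ N, ∀ i j, nrm (u j) * (nrm (a i) + |γ j| * nrm (z i) * θ) * y 0 +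
      nrm (u j) * (|γ j| * nrm (z i) * √(1 - θ ^ 2)) * y 1 ≤ 0 := by
    rintro y ⟨h0, h1⟩ i j
    have p1 := nrm_nonneg (u j)
    have p2 := nrm_nonneg (a i)
    have p3 := nrm_nonneg (z i)
    refine add_nonpos ?_ (mul_nonpos_of_nonneg_of_nonpos (by positivity) h1)
    by_cases h : 0 ≤ θ
    · rw [hS, if_pos h] at h0
      exact mul_nonpos_of_nonneg_of_nonpos (by positivity) h0
    · rw [hS, if_neg h] at h0
      rw [hneg (not_le.1 h), zero_add]
      exact mul_nonpos_of_nonpos_of_nonneg (mul_nonpos_of_nonneg_of_nonpos p1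
        (mul_nonpos_of_nonneg_of_nonpos (by positivity) (not_le.1 h).le)) h0
  set E := {G | ∃ i, ∀ j,
    dotp (u j) (mulV G (a i)) + γ j * dotp (u j) (mulV G (z i)) < l i j}
  calc stdMat m n E = stdMat m n E * (4 * 4⁻¹) := by
        rw [ENNReal.mul_inv_cancel (by simp) (by simp), mul_one]
    _ ≤ stdMat m n E * (4 * stdVec 2 N) := by gcongr
    _ = 4 * ((stdMat m n).prod (stdVec 2)) (E ×ˢ N) := by rw [Measure.prod_prod]; ring
    _ ≤ _ := by
      refine mul_le_mul_right ((measure_mono ?_).trans (gordon.trans (measure_mono ?_))) 4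
      · rintro ⟨G, y⟩ ⟨⟨i, hi⟩, hy⟩
        refine ⟨i, fun j => ?_⟩
        have := hN y hy i j
        have := hi j
        rw [dotp_mulV_eq_sum] at this
        simp only [α, Fintype.sum_sum_type, Sum.elim_inl, Sum.elim_inr, Fin.sum_univ_two,
          Matrix.cons_val_zero, Matrix.cons_val_one]
        linarith
      · rintro ω ⟨i, hi⟩
        refine ⟨i, fun j => ?_⟩
        have := hi j
        rw [decoupled_eq_sum]
        simpa only [β, Fintype.sum_sum_type, Sum.elim_inl, Sum.elim_inr] using this

theorem continuous_nrm {k : ℕ} : Continuous (nrm : (Fin k → ℝ) → ℝ) := by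
  unfold nrm
  fun_prop

/-- The comparison for a compact minimization set and a separable maximization set; `a c`, `z c`
stand for `x − r Z(x)`, `Z(x)`. -/
theorem measure_exists_forall_le_four_mul {m n : ℕ} {C T : Type*} [TopologicalSpace C]
    [CompactSpace C] [TopologicalSpace.SeparableSpace C] [Nonempty C] [TopologicalSpace T]
    [TopologicalSpace.SeparableSpace T] [Nonempty T] {θ : ℝ} (hθ : θ ^ 2 ≤ 1)
    {a z : C → Fin n → ℝ} {u : T → Fin m → ℝ} {γ : T → ℝ} {ψ : C → T → ℝ} (ha : Continuous a)
    (hz : Continuous z) (hu : Continuous u) (hγ : Continuous γ)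
    (hψ : Continuous fun p : C × T => ψ p.1 p.2) (hzz : ∀ c c', nrm (z c) = nrm (z c'))
    (hza : ∀ c c', dotp (z c) (a c') ≤ θ * (nrm (a c') * nrm (z c')))
    (hza' : ∀ c, dotp (z c) (a c) = θ * (nrm (a c) * nrm (z c)))
    (hneg : θ < 0 → ∀ c, nrm (a c) = 0) (t : ℝ) :
    ((stdMat m n).prod ((stdVec m).prod ((stdVec m).prod (stdVec n)))) {ω | ∃ c, ∀ τ,
        dotp (u τ) (mulV ω.1 (a c)) + γ τ * dotp (u τ) (mulV ω.1 (z c)) + ψ c τ ≤ t} ≤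
      4 * ((stdMat m n).prod ((stdVec m).prod ((stdVec m).prod (stdVec n)))) {ω | ∃ c, ∀ τ,
        nrm (a c) * dotp ω.2.1 (u τ) - nrm (u τ) * dotp ω.2.2.2 (a c) +
          γ τ * nrm (z c) * dotp (fun k => θ * ω.2.1 k + √(1 - θ ^ 2) * ω.2.2.1 k) (u τ) -
          |γ τ| * nrm (u τ) * dotp ω.2.2.2 (z c) + ψ c τ ≤ t} := by
  have hna : Continuous fun c => nrm (a c) := continuous_nrm.comp ha
  have hnz : Continuous fun c => nrm (z c) := continuous_nrm.comp hz
  have hnu : Continuous fun τ => nrm (u τ) := continuous_nrm.comp hu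
  have hψ₁ : ∀ τ, Continuous fun c => ψ c τ := fun τ =>
    hψ.comp (Continuous.prodMk_left τ)
  have hψ₂ : ∀ c, Continuous fun τ => ψ c τ := fun c =>
    hψ.comp (Continuous.prodMk_right c)
  have hF : ∀ (ω : (Fin m → Fin n → ℝ) × ((Fin m → ℝ) × ((Fin m → ℝ) × (Fin n → ℝ)))) τ,
      Continuous fun c =>
        dotp (u τ) (mulV ω.1 (a c)) + γ τ * dotp (u τ) (mulV ω.1 (z c)) + ψ c τ := fun ω τ => by
    have := hψ₁ τ
    unfold dotp mulV
    fun_prop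
  let H : (Fin m → Fin n → ℝ) × ((Fin m → ℝ) × ((Fin m → ℝ) × (Fin n → ℝ))) → C → T → ℝ :=
    fun ω c τ => nrm (a c) * dotp ω.2.1 (u τ) - nrm (u τ) * dotp ω.2.2.2 (a c) +
      γ τ * nrm (z c) * dotp (fun k => θ * ω.2.1 k + √(1 - θ ^ 2) * ω.2.2.1 k) (u τ) -
      |γ τ| * nrm (u τ) * dotp ω.2.2.2 (z c) + ψ c τ
  have hH : ∀ ω τ, Continuous fun c => H ω c τ := fun ω τ => by
    have := hψ₁ τ
    unfold H dotp
    fun_prop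
  have hH' : ∀ ω c, Continuous fun τ => H ω c τ := fun ω c => by
    have := hψ₂ c
    unfold H dotp
    fun_prop
  have hHm : ∀ c τ, Measurable fun ω => H ω c τ := fun c τ => by
    unfold H dotp
    fun_prop
  refine measure_exists_forall_le_of_finite _ _ H hF hH hH' hHm 4 (by simp) ?_ t
  intro N k c τ s
  have key := measure_exists_forall_lt_le_four_mul hθ (fun i => a (c i)) (fun i => z (c i))
    (fun j => u (τ j)) (fun j => γ (τ j)) (fun _ _ => hzz _ _) (fun _ _ => hza _ _)
    (fun _ => hza' _) (fun h _ => hneg h _) (fun i j => s - ψ (c i) (τ j))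
  simp only [lt_sub_iff_add_lt, le_sub_iff_add_le] at key
  have hfst := Measure.prod_prod (μ := stdMat m n)
    (ν := (stdVec m).prod ((stdVec m).prod (stdVec n))) {G | ∃ i, ∀ j, dotp (u (τ j))
      (mulV G (a (c i))) + γ (τ j) * dotp (u (τ j)) (mulV G (z (c i))) + ψ (c i) (τ j) < s}
    Set.univ
  have hsnd := Measure.prod_prod (μ := stdMat m n)
    (ν := (stdVec m).prod ((stdVec m).prod (stdVec n))) Set.univ {ω | ∃ i, ∀ j,
      nrm (a (c i)) * dotp ω.1 (u (τ j)) - nrm (u (τ j)) * dotp ω.2.2 (a (c i)) +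
        γ (τ j) * nrm (z (c i)) *
          dotp (fun k => θ * ω.1 k + √(1 - θ ^ 2) * ω.2.1 k) (u (τ j)) -
        |γ (τ j)| * nrm (u (τ j)) * dotp ω.2.2 (z (c i)) + ψ (c i) (τ j) ≤ s}
  rw [measure_univ, mul_one, Set.prod_univ] at hfst
  rw [measure_univ, one_mul, Set.univ_prod] at hsnd
  rw [← hfst, ← hsnd] at key
  exact key

theorem continuousAt_realSign {t : ℝ} (ht : t ≠ 0) : ContinuousAt Real.sign t := by
  rcases lt_or_gt_of_ne ht with h | h
  · exact continuousAt_const.congr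
      ((gt_mem_nhds h).mono fun y hy => (Real.sign_of_neg hy).symm)
  · exact continuousAt_const.congr
      ((lt_mem_nhds h).mono fun y hy => (Real.sign_of_pos hy).symm)

theorem continuousOn_Zv {n : ℕ} (L : ℝ) {s : Set (Fin n → ℝ)} (hs : ∀ x ∈ s, ∀ i, x i ≠ 0) :
    ContinuousOn (Zv L) s :=
  continuousOn_pi.2 fun i x hx => ContinuousAt.continuousWithinAt <|
    continuousAt_const.mul <| (continuousAt_realSign (hs x hx i)).comp
      (f := fun y : Fin n → ℝ => y i) (continuous_apply i).continuousAt

theorem continuousOn_xr {n : ℕ} (L r : ℝ) {s : Set (Fin n → ℝ)} (hs : ∀ x ∈ s, ∀ i, x i ≠ 0) :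
    ContinuousOn (xr L r) s :=
  continuousOn_id.sub ((continuousOn_Zv L hs).const_smul r)

/-- the new Gaussian min-max comparison theorem for one-bit quantized
precoding.  The sample `ω = (G, (g, (f, h)))` consists of independent standard Gaussian
matrix/vectors; the event `{minsup ≤ t}` is expressed as
`∃ (d, x) feasible, ∀ (u, γ) feasible, process ≤ t`. -/
theorem stmt8 (m n : ℕ) (L r θ t : ℝ) (hL : 0 < L) (hr : 0 < r)
    (hθ : -1 ≤ θ) (hθ' : θ ≤ 1)
    (Sd Su : Set (Fin m → ℝ)) (hSd : IsCompact Sd) (hSu : IsCompact Su)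
    (St : Set (Fin n → ℝ)) (hStc : IsCompact St)
    (hSt : ∀ x ∈ St, (∀ i, x i ≠ 0) ∧ (∀ i, x i ∉ Set.Ioo (-(L * r)) (L * r)) ∧
      dotp (xr L r x) (Zv L x) = θ * (nrm (xr L r x) * nrm (Zv L x)))
    (Sγ : Set ℝ) (hSγ : IsCompact Sγ ∨ Sγ = Set.univ)
    (ψ : (Fin m → ℝ) → (Fin n → ℝ) → (Fin m → ℝ) → ℝ → ℝ)
    (hψ : ContinuousOn (fun p : ((Fin m → ℝ) × (Fin n → ℝ) × (Fin m → ℝ) × ℝ) =>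
      ψ p.1 p.2.1 p.2.2.1 p.2.2.2) (Sd ×ˢ St ×ˢ Su ×ˢ Sγ)) :
    ((stdMat m n).prod ((stdVec m).prod ((stdVec m).prod (stdVec n))))
        {ω : (Fin m → Fin n → ℝ) × ((Fin m → ℝ) × ((Fin m → ℝ) × (Fin n → ℝ))) |
          ∃ d ∈ Sd, ∃ x ∈ St, ∀ u ∈ Su, ∀ γ ∈ Sγ,
            dotp u (mulV ω.1 (xr L r x)) + γ * dotp u (mulV ω.1 (Zv L x)) +
              ψ d x u γ ≤ t} ≤
      4 * ((stdMat m n).prod ((stdVec m).prod ((stdVec m).prod (stdVec n))))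
        {ω : (Fin m → Fin n → ℝ) × ((Fin m → ℝ) × ((Fin m → ℝ) × (Fin n → ℝ))) |
          ∃ d ∈ Sd, ∃ x ∈ St, ∀ u ∈ Su, ∀ γ ∈ Sγ,
            nrm (xr L r x) * dotp ω.2.1 u - nrm u * dotp ω.2.2.2 (xr L r x) +
              γ * nrm (Zv L x) *
                dotp (fun k => θ * ω.2.1 k + Real.sqrt (1 - θ ^ 2) * ω.2.2.1 k) u -
              |γ| * nrm u * dotp ω.2.2.2 (Zv L x) + ψ d x u γ ≤ t} := by
  rcases Sd.eq_empty_or_nonempty with rfl | hSdn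
  · simp
  rcases St.eq_empty_or_nonempty with rfl | hStn
  · simp
  by_cases hT : Su.Nonempty ∧ Sγ.Nonempty
  swap
  · refine (measure_mono ?_).trans (le_mul_of_one_le_left' (by norm_num))
    rintro ω ⟨d, hd, x, hx, -⟩
    exact ⟨d, hd, x, hx, fun u hu γ hγ => (hT ⟨⟨u, hu⟩, ⟨γ, hγ⟩⟩).elim⟩
  have := hSdn.to_subtype
  have := hStn.to_subtype
  have := hT.1.to_subtype
  have := hT.2.to_subtype
  have := isCompact_iff_compactSpace.1 hSd
  have := isCompact_iff_compactSpace.1 hStc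
  have hψ' : Continuous fun p : (Sd × St) × (Su × Sγ) =>
      ψ (p.1.1 : Fin m → ℝ) (p.1.2 : Fin n → ℝ) (p.2.1 : Fin m → ℝ) (p.2.2 : ℝ) :=
    hψ.comp_continuous (f := fun p : (Sd × St) × (Su × Sγ) =>
      ((p.1.1 : Fin m → ℝ), (p.1.2 : Fin n → ℝ), (p.2.1 : Fin m → ℝ), (p.2.2 : ℝ)))
      (by fun_prop) fun p => ⟨p.1.1.2, p.1.2.2, p.2.1.2, p.2.2.2⟩
  have main := measure_exists_forall_le_four_mul (C := Sd × St) (T := Su × Sγ)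
    (a := fun c : Sd × St => xr L r (c.2 : Fin n → ℝ))
    (z := fun c : Sd × St => Zv L (c.2 : Fin n → ℝ)) (u := fun τ : Su × Sγ => (τ.1 : Fin m → ℝ))
    (γ := fun τ : Su × Sγ => (τ.2 : ℝ))
    (ψ := fun (c : Sd × St) (τ : Su × Sγ) => ψ c.1 c.2 τ.1 τ.2)
    (show θ ^ 2 ≤ 1 by nlinarith)
    ((continuousOn_xr L r fun x hx => (hSt x hx).1).domRestrict.comp continuous_snd)
    ((continuousOn_Zv L fun x hx => (hSt x hx).1).domRestrict.comp continuous_snd)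
    (by fun_prop) (by fun_prop) hψ'
    (fun c c' => by rw [nrm_Zv L (hSt _ c.2.2).1, nrm_Zv L (hSt _ c'.2.2).1])
    (fun c c' => by
      obtain ⟨h1, h2, h3⟩ := hSt _ c'.2.2
      exact (dotp_Zv_le hL _ h1 h2).trans_eq ((dotp_comm _ _).trans h3))
    (fun c => (dotp_comm _ _).trans (hSt _ c.2.2).2.2)
    (fun h c => by
      obtain ⟨h1, h2, h3⟩ := hSt _ c.2.2
      exact nrm_xr_eq_zero hL h h1 h2 h3) t
  simpa only [Prod.exists, Prod.forall, Subtype.exists, Subtype.forall, exists_prop] using main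
end

section
/- Fix A > 0, L > 0, λ ≥ 0, δ > 0 and C_u > 0. There exist constants C, c, C̃ > 0 and ε₀ ∈ (0,1), depending only on (A, L, λ, δ, C_u), such that for every n (with m = δn), every s ∈ {−1,+1}^m and every ε ∈ (0, ε₀), with probability at least 1 − C·exp(−c n) over H, the following holds: for every x ∈ ℝⁿ with ‖x‖∞ ≤ A and #{i : |x_i| ≤ Lε²} ≤ C_u·n·ε², there exists y ∈ ℝⁿ with ‖y‖∞ ≤ A such that (i) |P(x;1) − P(y;1)| ≤ C̃·max(ε⁶, ε²/√n); (ii) (1/m)·‖H·(L sign(x)) − H·(L sign(y))‖₂² ≤ C̃·ε²; (iii) (1/n)·‖x − y‖₂² ≤ C̃·ε⁶; (iv) no entry of y lies in (−Lε², Lε²). -/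
open MeasureTheory ProbabilityTheory Real
open scoped ENNReal NNReal

/-- Law of an `m × n` random matrix with i.i.d. centered Gaussian entries of variance `1/n`. -/
noncomputable def matMeasure (m n : ℕ) : Measure (Fin m → Fin n → ℝ) :=
  Measure.pi fun _ : Fin m => Measure.pi fun _ : Fin n => gaussianReal 0 ((n : ℝ≥0))⁻¹

/-- The precoding cost `P(x; 1) = (1/n)‖Hx − s‖² + (λ/n)‖x‖²`. -/
noncomputable def cost1 (m n : ℕ) (lam : ℝ) (s : Fin m → ℝ)
    (H : Fin m → Fin n → ℝ) (x : Fin n → ℝ) : ℝ :=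
  (∑ k, (mulV H x k - s k) ^ 2) / n + lam * (∑ i, (x i) ^ 2) / n

/-- The lattice points of squared norm at most `4 d` in dimension `d`. -/
noncomputable def latticeBall (d : ℕ) : Finset (Fin d → ℤ) :=
  (Fintype.piFinset fun _ => Finset.Icc (-(4 * d : ℤ)) (4 * d)).filter
    fun z => ∑ i, z i ^ 2 ≤ 4 * d

theorem mem_latticeBall {d : ℕ} {z : Fin d → ℤ} :
    z ∈ latticeBall d ↔ ∑ i, z i ^ 2 ≤ 4 * d := by
  simp only [latticeBall, Finset.mem_filter, Fintype.mem_piFinset, Finset.mem_Icc,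
    and_iff_right_iff_imp]
  intro h i
  have h1 : z i ^ 2 ≤ ∑ i, z i ^ 2 :=
    Finset.single_le_sum (f := fun i => z i ^ 2) (fun j _ => sq_nonneg _) (Finset.mem_univ i)
  have h2 : |z i| ≤ z i ^ 2 := by
    rw [← sq_abs]
    rcases (abs_nonneg (z i)).eq_or_lt with h0 | h0
    · rw [← h0]; norm_num
    · nlinarith
  have h3 := abs_le.1 (h2.trans (h1.trans h))
  exact ⟨h3.1, h3.2⟩

theorem summable_half_pow_natAbs : Summable fun j : ℤ => (1 / 2 : ℝ) ^ j.natAbs := by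
  apply Summable.of_nat_of_neg <;> simpa using summable_geometric_two

/-- The number of lattice points in the ball grows at most exponentially with the dimension. -/
theorem exists_card_latticeBall_le :
    ∃ b : ℝ, 0 < b ∧ ∀ d : ℕ, ((latticeBall d).card : ℝ) ≤ exp (b * d) := by
  set S : ℝ := ∑' j : ℤ, (1 / 2 : ℝ) ^ j.natAbs with hS
  have hS1 : 1 ≤ S :=
    (by simp : (1 : ℝ) = (1 / 2) ^ (0 : ℤ).natAbs).trans_le
      (summable_half_pow_natAbs.le_tsum 0 fun j _ => by positivity)
  refine ⟨log (16 * S), log_pos (by linarith), fun d => ?_⟩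
  have hexp : exp (log (16 * S) * d) = (16 : ℝ) ^ d * S ^ d := by
    rw [mul_comm, exp_nat_mul, exp_log (by linarith), mul_pow]
  rw [hexp]
  calc ((latticeBall d).card : ℝ)
      = ∑ z ∈ latticeBall d, (1 : ℝ) := by simp
    _ ≤ ∑ z ∈ latticeBall d, (16 : ℝ) ^ d * ∏ i, (1 / 2 : ℝ) ^ (z i).natAbs := by
        refine Finset.sum_le_sum fun z hz => ?_
        rw [mem_latticeBall] at hz
        have hle : ∑ i, (z i).natAbs ≤ 4 * d := by
          zify
          refine le_trans (Finset.sum_le_sum fun i _ => ?_) hz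
          rw [← sq_abs]
          rcases (abs_nonneg (z i)).eq_or_lt with h0 | h0
          · rw [← h0]; norm_num
          · nlinarith
        rw [Finset.prod_pow_eq_pow_sum]
        calc (1 : ℝ) = 16 ^ d * (1 / 2) ^ (4 * d) := by
              rw [pow_mul, ← mul_pow]; norm_num
          _ ≤ _ := by
              gcongr (16 : ℝ) ^ d * ?_
              exact pow_le_pow_of_le_one (by norm_num) (by norm_num) hle
    _ ≤ ∑ z ∈ Fintype.piFinset fun _ : Fin d => Finset.Icc (-(4 * d : ℤ)) (4 * d),
          (16 : ℝ) ^ d * ∏ i, (1 / 2 : ℝ) ^ (z i).natAbs :=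
        Finset.sum_le_sum_of_subset_of_nonneg (Finset.filter_subset _ _)
          fun _ _ _ => by positivity
    _ = 16 ^ d * ∏ _i : Fin d, ∑ j ∈ Finset.Icc (-(4 * d : ℤ)) (4 * d),
          (1 / 2 : ℝ) ^ j.natAbs := by
        rw [← Finset.mul_sum, Finset.sum_prod_piFinset _ fun (_ : Fin d) (j : ℤ) => (1 / 2 : ℝ) ^ j.natAbs]
    _ ≤ 16 ^ d * S ^ d := by
        rw [Finset.prod_const, Finset.card_univ, Fintype.card_fin]
        gcongr
        exact summable_half_pow_natAbs.sum_le_tsum _ fun _ _ => by positivity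

theorem mulV_eq_sum_swap {m n : ℕ} (H : Fin m → Fin n → ℝ) (u : Fin m → ℝ) (v : Fin n → ℝ) :
    ∑ k, u k * mulV H v k = ∑ i, (∑ k, u k * H k i) * v i := by
  simp only [mulV, Finset.mul_sum, Finset.sum_mul]
  rw [Finset.sum_comm]
  exact Finset.sum_congr rfl fun i _ => Finset.sum_congr rfl fun k _ => by ring

/-- Rounding each coordinate in the direction favourable to a linear functional. -/
theorem exists_int_rounding {d : ℕ} (c v : Fin d → ℝ) (hv : ∑ i, v i ^ 2 ≤ d) :
    ∃ z ∈ latticeBall d, ∑ i, c i * v i ≤ ∑ i, c i * z i := by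
  have key : ∀ i, ∃ z : ℤ, (z : ℝ) ^ 2 ≤ 2 * v i ^ 2 + 2 ∧ c i * v i ≤ c i * z := by
    intro i
    rcases le_total 0 (c i) with h | h
    · refine ⟨⌈v i⌉, ?_, mul_le_mul_of_nonneg_left (Int.le_ceil _) h⟩
      nlinarith [Int.le_ceil (v i), Int.ceil_lt_add_one (v i), sq_nonneg ((⌈v i⌉ : ℝ) - 2 * v i)]
    · refine ⟨⌊v i⌋, ?_, mul_le_mul_of_nonpos_left (Int.floor_le _) h⟩
      nlinarith [Int.floor_le (v i), Int.lt_floor_add_one (v i),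
        sq_nonneg ((⌊v i⌋ : ℝ) - 2 * v i)]
  choose z hz hc using key
  refine ⟨z, mem_latticeBall.2 ?_, Finset.sum_le_sum fun i _ => hc i⟩
  have : ∑ i, (z i : ℝ) ^ 2 ≤ 4 * d := by
    refine (Finset.sum_le_sum fun i _ => hz i).trans ?_
    rw [Finset.sum_add_distrib, ← Finset.mul_sum]
    simp
    linarith
  exact_mod_cast this

instance (m n : ℕ) : IsProbabilityMeasure (matMeasure m n) := by
  unfold matMeasure; infer_instance

/-- Chernoff bound for a bilinear form in a Gaussian matrix. -/
theorem measure_bilin_ge_le {m n : ℕ} (u : Fin m → ℝ) (v : Fin n → ℝ) (T : ℝ) :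
    (matMeasure m n).real {H | T ≤ ∑ k, u k * mulV H v k} ≤
      exp (-T + (∑ k, u k ^ 2) * (∑ i, v i ^ 2) / n / 2) := by
  have hfac : ∀ H : Fin m → Fin n → ℝ, exp (1 * ∑ k, u k * mulV H v k) =
      ∏ k, ∏ i, exp (u k * v i * H k i) := by
    intro H
    simp only [← exp_sum, one_mul, mulV, Finset.mul_sum]
    congr 1
    exact Finset.sum_congr rfl fun k _ => Finset.sum_congr rfl fun i _ => by ring
  have hint : Integrable (fun H : Fin m → Fin n → ℝ => exp (1 * ∑ k, u k * mulV H v k))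
      (matMeasure m n) := by
    simp only [hfac]
    unfold matMeasure
    refine Integrable.fintype_prod (f := fun k (r : Fin n → ℝ) => ∏ i, exp (u k * v i * r i))
      fun k => ?_
    exact Integrable.fintype_prod (f := fun i (t : ℝ) => exp (u k * v i * t))
      fun i => integrable_exp_mul_gaussianReal _
  have hmgf : mgf (fun H : Fin m → Fin n → ℝ => ∑ k, u k * mulV H v k) (matMeasure m n) 1 =
      exp ((∑ k, u k ^ 2) * (∑ i, v i ^ 2) / n / 2) := by
    simp only [mgf, hfac]
    unfold matMeasure
    rw [integral_fintype_prod_eq_prod (fun k (r : Fin n → ℝ) => ∏ i, exp (u k * v i * r i))]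
    have hrow : ∀ k, ∫ r : Fin n → ℝ, ∏ i, exp (u k * v i * r i)
        ∂(Measure.pi fun _ : Fin n => gaussianReal 0 ((n : ℝ≥0))⁻¹) =
        exp (∑ i, (u k * v i) ^ 2 / n / 2) := by
      intro k
      rw [integral_fintype_prod_eq_prod (fun i (t : ℝ) => exp (u k * v i * t)), exp_sum]
      refine Finset.prod_congr rfl fun i _ => ?_
      have := congrFun (mgf_id_gaussianReal (μ := 0) (v := ((n : ℝ≥0))⁻¹)) (u k * v i)
      simp only [mgf, id] at this
      rw [this]
      congr 1
      push_cast
      ring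
    simp only [hrow]
    rw [← exp_sum]
    congr 1
    simp only [Finset.sum_mul_sum, Finset.sum_div]
    exact Finset.sum_congr rfl fun k _ => Finset.sum_congr rfl fun i _ => by rw [mul_pow]
  refine (measure_ge_le_exp_mul_mgf T zero_le_one hint).trans_eq ?_
  rw [hmgf, ← exp_add]
  ring_nf

/-- `H` is bounded by `√κ` as a bilinear form. -/
def BilinBound {m n : ℕ} (κ : ℝ) (H : Fin m → Fin n → ℝ) : Prop :=
  ∀ (u : Fin m → ℝ) (v : Fin n → ℝ),
    (∑ k, u k * mulV H v k) ^ 2 ≤ κ * (∑ k, u k ^ 2) * ∑ i, v i ^ 2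

theorem mulV_smul {m n : ℕ} (H : Fin m → Fin n → ℝ) (t : ℝ) (v : Fin n → ℝ) (k : Fin m) :
    mulV H (fun i => t * v i) k = t * mulV H v k := by
  simp only [mulV, Finset.mul_sum]
  exact Finset.sum_congr rfl fun i _ => by ring

theorem bilinBound_of_lattice {m n : ℕ} {T : ℝ} (hm : 0 < m) (hn : 0 < n)
    (H : Fin m → Fin n → ℝ)
    (hH : ∀ z ∈ latticeBall m, ∀ w ∈ latticeBall n,
      ∑ k, (z k : ℝ) * mulV H (fun i => (w i : ℝ)) k ≤ T) :
    BilinBound (T ^ 2 / (m * n)) H := by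
  have hball : ∀ (u : Fin m → ℝ) (v : Fin n → ℝ), ∑ k, u k ^ 2 ≤ m → ∑ i, v i ^ 2 ≤ n →
      ∑ k, u k * mulV H v k ≤ T := by
    intro u v hu hv
    obtain ⟨w, hw, hw'⟩ := exists_int_rounding (fun i => ∑ k, u k * H k i) v hv
    obtain ⟨z, hz, hz'⟩ := exists_int_rounding (mulV H fun i => (w i : ℝ)) u hu
    rw [mulV_eq_sum_swap]
    refine hw'.trans ?_
    rw [← mulV_eq_sum_swap H u fun i => (w i : ℝ)]
    simp only [mul_comm (mulV H _ _)] at hz'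
    exact hz'.trans (hH z hz w hw)
  have hm' : (0 : ℝ) < m := by exact_mod_cast hm
  have hn' : (0 : ℝ) < n := by exact_mod_cast hn
  intro u v
  set a := ∑ k, u k ^ 2 with ha
  set b := ∑ i, v i ^ 2 with hb
  have ha0 : 0 ≤ a := Finset.sum_nonneg fun _ _ => sq_nonneg _
  have hb0 : 0 ≤ b := Finset.sum_nonneg fun _ _ => sq_nonneg _
  rcases ha0.eq_or_lt with h0 | hapos
  · have : ∀ k, u k = 0 := fun k => by
      have := (Finset.sum_eq_zero_iff_of_nonneg (fun _ _ => sq_nonneg _)).1 h0.symm k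
        (Finset.mem_univ k)
      exact pow_eq_zero_iff (two_ne_zero) |>.1 this
    simp [this, ← h0]
  rcases hb0.eq_or_lt with h0 | hbpos
  · have : ∀ k, v k = 0 := fun k => by
      have := (Finset.sum_eq_zero_iff_of_nonneg (fun _ _ => sq_nonneg _)).1 h0.symm k
        (Finset.mem_univ k)
      exact pow_eq_zero_iff (two_ne_zero) |>.1 this
    simp [this, ← h0, mulV]
  have hscaled : ∀ p q : ℝ, p ^ 2 = m / a → q ^ 2 = n / b →
      p * q * ∑ k, u k * mulV H v k ≤ T := by
    intro p q hp hq
    have := hball (fun k => p * u k) (fun i => q * v i)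
      (by simp only [mul_pow, ← Finset.mul_sum]; rw [hp, ← ha, div_mul_cancel₀ _ hapos.ne'])
      (by simp only [mul_pow, ← Finset.mul_sum]; rw [hq, ← hb, div_mul_cancel₀ _ hbpos.ne'])
    refine le_of_eq_of_le ?_ this
    simp only [mulV_smul, Finset.mul_sum]
    exact Finset.sum_congr rfl fun k _ => by ring
  have hp : √(m / a) ^ 2 = m / a := sq_sqrt (by positivity)
  have hq : √(n / b) ^ 2 = n / b := sq_sqrt (by positivity)
  have h1 := hscaled _ _ hp hq
  have h2 := hscaled (-√(m / a)) _ (by rw [neg_sq, hp]) hq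
  have h3 : (√(m / a) * √(n / b) * ∑ k, u k * mulV H v k) ^ 2 ≤ T ^ 2 :=
    sq_le_sq' (by linarith) h1
  rw [mul_pow, mul_pow, hp, hq] at h3
  calc (∑ k, u k * mulV H v k) ^ 2
      = (m / a * (n / b) * (∑ k, u k * mulV H v k) ^ 2) * (a * b / (m * n)) := by
        field_simp
    _ ≤ T ^ 2 * (a * b / (m * n)) := by gcongr
    _ = T ^ 2 / (m * n) * a * b := by ring

theorem BilinBound.sum_mulV_sq_le {m n : ℕ} {κ : ℝ} {H : Fin m → Fin n → ℝ}
    (hκ : 0 ≤ κ) (h : BilinBound κ H) (v : Fin n → ℝ) :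
    ∑ k, mulV H v k ^ 2 ≤ κ * ∑ i, v i ^ 2 := by
  have h1 := h (mulV H v) v
  simp only [← sq] at h1
  have hb0 : 0 ≤ ∑ i, v i ^ 2 := Finset.sum_nonneg fun _ _ => sq_nonneg _
  by_contra! hlt
  have : 0 ≤ κ * ∑ i, v i ^ 2 := by positivity
  nlinarith

theorem BilinBound.sum_transpose_sq_le {m n : ℕ} {κ : ℝ} {H : Fin m → Fin n → ℝ}
    (hκ : 0 ≤ κ) (h : BilinBound κ H) (u : Fin m → ℝ) :
    ∑ i, (∑ k, u k * H k i) ^ 2 ≤ κ * ∑ k, u k ^ 2 := by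
  have h1 := h u fun i => ∑ k, u k * H k i
  rw [mulV_eq_sum_swap] at h1
  simp only [← sq] at h1
  have hb0 : 0 ≤ ∑ k, u k ^ 2 := Finset.sum_nonneg fun _ _ => sq_nonneg _
  by_contra! hlt
  have : 0 ≤ κ * ∑ k, u k ^ 2 := by positivity
  nlinarith

/-- A Gaussian matrix with aspect ratio `δ` is bounded up to an exponentially small probability. -/
theorem exists_measure_not_bilinBound_le (δ : ℝ) (hδ : 0 < δ) :
    ∃ κ : ℝ, 0 < κ ∧ ∀ n m : ℕ, 0 < n → (m : ℝ) = δ * n →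
      matMeasure m n {H | ¬ BilinBound κ H} ≤ ENNReal.ofReal (exp (-n)) := by
  obtain ⟨b, hb, hcard⟩ := exists_card_latticeBall_le
  set K : ℝ := 8 * δ + b * δ + b + 1 with hK
  have hKpos : 0 < K := by positivity
  refine ⟨K ^ 2 / δ, by positivity, fun n m hn hmn => ?_⟩
  have hn' : (0 : ℝ) < n := by exact_mod_cast hn
  have hm : 0 < m := by
    have : (0 : ℝ) < m := by rw [hmn]; positivity
    exact_mod_cast this
  have hsub : {H : Fin m → Fin n → ℝ | ¬ BilinBound (K ^ 2 / δ) H} ⊆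
      ⋃ p ∈ latticeBall m ×ˢ latticeBall n,
        {H | K * n ≤ ∑ k, (p.1 k : ℝ) * mulV H (fun i => (p.2 i : ℝ)) k} := by
    intro H hH
    by_contra hnot
    refine hH ?_
    have heq : K ^ 2 / δ = (K * n) ^ 2 / (m * n) := by
      rw [hmn]; field_simp
    rw [heq]
    refine bilinBound_of_lattice hm hn H fun z hz w hw => ?_
    by_contra! hlt
    exact hnot (Set.mem_biUnion (x := (z, w)) (Finset.mem_product.2 ⟨hz, hw⟩) hlt.le)
  have hone : ∀ p ∈ latticeBall m ×ˢ latticeBall n,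
      matMeasure m n {H | K * n ≤ ∑ k, (p.1 k : ℝ) * mulV H (fun i => (p.2 i : ℝ)) k} ≤
        ENNReal.ofReal (exp (-(K * n) + 8 * δ * n)) := by
    intro p hp
    rw [Finset.mem_product, mem_latticeBall, mem_latticeBall] at hp
    have h1 : ∑ k, (p.1 k : ℝ) ^ 2 ≤ 4 * m := by exact_mod_cast hp.1
    have h2 : ∑ i, (p.2 i : ℝ) ^ 2 ≤ 4 * n := by exact_mod_cast hp.2
    rw [← ofReal_measureReal]
    refine ENNReal.ofReal_le_ofReal ((measure_bilin_ge_le _ _ _).trans (exp_le_exp.2 ?_))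
    gcongr
    calc (∑ k, (p.1 k : ℝ) ^ 2) * (∑ i, (p.2 i : ℝ) ^ 2) / n / 2
        ≤ (4 * m) * (4 * n) / n / 2 := by gcongr
      _ = 8 * δ * n := by rw [hmn]; field_simp; norm_num
  calc matMeasure m n {H | ¬ BilinBound (K ^ 2 / δ) H}
      ≤ ∑ p ∈ latticeBall m ×ˢ latticeBall n, ENNReal.ofReal (exp (-(K * n) + 8 * δ * n)) :=
        (measure_mono hsub).trans
          ((measure_biUnion_finset_le _ _).trans (Finset.sum_le_sum hone))
    _ = ENNReal.ofReal (((latticeBall m).card * (latticeBall n).card : ℝ) *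
          exp (-(K * n) + 8 * δ * n)) := by
        rw [Finset.sum_const, Finset.card_product, nsmul_eq_mul,
          ENNReal.ofReal_mul (by positivity), ← Nat.cast_mul, ENNReal.ofReal_natCast]
    _ ≤ ENNReal.ofReal (exp (b * m) * exp (b * n) * exp (-(K * n) + 8 * δ * n)) := by
        gcongr
        · exact hcard m
        · exact hcard n
    _ = ENNReal.ofReal (exp (-n)) := by
        rw [← exp_add, ← exp_add, hmn, hK]
        ring_nf

/-- Derandomized rounding to `±a`: small coordinates are moved to `±a` so that the total change
of a linear functional is no larger than its typical value under mean-preserving rounding. -/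
theorem exists_rounding_to_threshold {ι : Type*} (S : Finset ι) (x g : ι → ℝ) (a : ℝ)
    (hx : ∀ i ∈ S, |x i| ≤ a) :
    ∃ y : ι → ℝ, (∀ i ∈ S, y i = a ∨ y i = -a) ∧ (∀ i ∉ S, y i = x i) ∧
      (∑ i ∈ S, (y i - x i) * g i) ^ 2 ≤ a ^ 2 * ∑ i ∈ S, g i ^ 2 := by
  classical
  induction S using Finset.induction_on with
  | empty => exact ⟨x, by simp⟩
  | insert j S hj ih =>
    obtain ⟨y, hyS, hy, hsum⟩ := ih fun i hi => hx i (Finset.mem_insert_of_mem hi)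
    have hxj := abs_le.1 (hx j (Finset.mem_insert_self j S))
    set T := ∑ i ∈ S, (y i - x i) * g i with hT
    have hb : ∃ b : ℝ, (b = a ∨ b = -a) ∧
        ((b - x j) * g j + T) ^ 2 ≤ a ^ 2 * g j ^ 2 + T ^ 2 := by
      by_contra! hcon
      have h1 := hcon a (Or.inl rfl)
      have h2 := hcon (-a) (Or.inr rfl)
      have ha : 0 ≤ a := by linarith [hxj.1, hxj.2]
      rcases ha.eq_or_lt with ha0 | hapos
      · have hx0 : x j = 0 := by subst ha0; linarith [hxj.1, hxj.2]
        simp [← ha0, hx0] at h1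
      have h3 : (a + x j) * (a ^ 2 * g j ^ 2 + T ^ 2) ≤ (a + x j) * ((a - x j) * g j + T) ^ 2 :=
        mul_le_mul_of_nonneg_left h1.le (by linarith)
      have h4 : (a - x j) * (a ^ 2 * g j ^ 2 + T ^ 2) ≤ (a - x j) * ((-a - x j) * g j + T) ^ 2 :=
        mul_le_mul_of_nonneg_left h2.le (by linarith)
      have h5 : (a + x j) * (a ^ 2 * g j ^ 2 + T ^ 2) + (a - x j) * (a ^ 2 * g j ^ 2 + T ^ 2) <
          (a + x j) * ((a - x j) * g j + T) ^ 2 +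
            (a - x j) * ((-a - x j) * g j + T) ^ 2 := by
        rcases hxj.1.eq_or_lt with he | hlt
        · have : (a - x j) * (a ^ 2 * g j ^ 2 + T ^ 2) <
              (a - x j) * ((-a - x j) * g j + T) ^ 2 :=
            mul_lt_mul_of_pos_left h2 (by linarith)
          linarith
        · have : (a + x j) * (a ^ 2 * g j ^ 2 + T ^ 2) <
              (a + x j) * ((a - x j) * g j + T) ^ 2 :=
            mul_lt_mul_of_pos_left h1 (by linarith)
          linarith
      have h6 : 0 ≤ 2 * a * (x j * g j) ^ 2 := by positivity
      nlinarith
    obtain ⟨b, hb, hbT⟩ := hb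
    have hne : ∀ i ∈ S, i ≠ j := fun i hi he => hj (he ▸ hi)
    refine ⟨Function.update y j b, ?_, ?_, ?_⟩
    · intro i hi
      rcases Finset.mem_insert.1 hi with rfl | hi
      · simpa using hb
      · simpa [hne i hi] using hyS i hi
    · intro i hi
      rw [Finset.mem_insert, not_or] at hi
      simpa [hi.1] using hy i hi.2
    · rw [Finset.sum_insert hj, Finset.sum_insert hj]
      have : ∑ i ∈ S, (Function.update y j b i - x i) * g i = T :=
        Finset.sum_congr rfl fun i hi => by rw [Function.update_of_ne (hne i hi)]
      rw [this, Function.update_self]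
      linarith

theorem mulV_add {m n : ℕ} (H : Fin m → Fin n → ℝ) (v w : Fin n → ℝ) (k : Fin m) :
    mulV H (fun i => v i + w i) k = mulV H v k + mulV H w k := by
  simp only [mulV, mul_add, Finset.sum_add_distrib]

theorem mulV_sub {m n : ℕ} (H : Fin m → Fin n → ℝ) (v w : Fin n → ℝ) (k : Fin m) :
    mulV H (fun i => v i - w i) k = mulV H v k - mulV H w k := by
  simp only [mulV, mul_sub, Finset.sum_sub_distrib]

/-- The first and second order terms of the cost. -/
theorem cost1_sub {m n : ℕ} (lam : ℝ) (s : Fin m → ℝ) (H : Fin m → Fin n → ℝ)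
    (x y : Fin n → ℝ) :
    cost1 m n lam s H y - cost1 m n lam s H x =
      (2 * ∑ i, (y i - x i) * (∑ k, (mulV H x k - s k) * H k i + lam * x i) +
        ∑ k, mulV H (fun i => y i - x i) k ^ 2 + lam * ∑ i, (y i - x i) ^ 2) / n := by
  have h1 : ∑ i, (y i - x i) * (∑ k, (mulV H x k - s k) * H k i + lam * x i) =
      ∑ k, (mulV H x k - s k) * (mulV H y k - mulV H x k) +
        lam * ∑ i, x i * (y i - x i) := by
    simp only [← mulV_sub]
    rw [mulV_eq_sum_swap, Finset.mul_sum, ← Finset.sum_add_distrib]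
    exact Finset.sum_congr rfl fun i _ => by ring
  have h2 : ∑ k, (mulV H y k - s k) ^ 2 = ∑ k, (mulV H x k - s k) ^ 2 +
      2 * ∑ k, (mulV H x k - s k) * (mulV H y k - mulV H x k) +
        ∑ k, mulV H (fun i => y i - x i) k ^ 2 := by
    simp only [mulV_sub]
    rw [Finset.mul_sum, ← Finset.sum_add_distrib, ← Finset.sum_add_distrib]
    exact Finset.sum_congr rfl fun i _ => by ring
  have h3 : ∑ i, y i ^ 2 = ∑ i, x i ^ 2 + 2 * ∑ i, x i * (y i - x i) +
      ∑ i, (y i - x i) ^ 2 := by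
    rw [Finset.mul_sum, ← Finset.sum_add_distrib, ← Finset.sum_add_distrib]
    exact Finset.sum_congr rfl fun i _ => by ring
  rw [cost1, cost1, h1, h2, h3]
  ring

theorem sum_sq_le_of_support {ι : Type*} [Fintype ι] (S : Finset ι) (d : ι → ℝ) (r : ℝ)
    (hS : ∀ i ∈ S, |d i| ≤ r) (h0 : ∀ i ∉ S, d i = 0) :
    ∑ i, d i ^ 2 ≤ S.card * r ^ 2 := by
  rw [← Finset.sum_subset (Finset.subset_univ S) fun i _ hi => by rw [h0 i hi]; norm_num,
    ← nsmul_eq_mul]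
  refine Finset.sum_le_card_nsmul _ _ _ fun i hi => ?_
  rw [← sq_abs]
  exact pow_le_pow_left₀ (abs_nonneg _) (hS i hi) 2

/-- The squared norm of the gradient of the cost is of order `n` on the box. -/
theorem BilinBound.sum_grad_sq_le {m n : ℕ} {κ A lam δ : ℝ} {H : Fin m → Fin n → ℝ}
    (hκ : 0 ≤ κ) (h : BilinBound κ H) (hmn : (m : ℝ) = δ * n) {s : Fin m → ℝ}
    (hs : ∀ k, s k = 1 ∨ s k = -1) {x : Fin n → ℝ} (hx : ∀ i, |x i| ≤ A) :
    ∑ i, (∑ k, (mulV H x k - s k) * H k i + lam * x i) ^ 2 ≤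
      (2 * κ * (2 * κ * A ^ 2 + 2 * δ) + 2 * lam ^ 2 * A ^ 2) * n := by
  have hx2 : ∑ i, x i ^ 2 ≤ n * A ^ 2 := by
    simpa using sum_sq_le_of_support Finset.univ x A (fun i _ => hx i) (by simp)
  have hs2 : ∑ k, s k ^ 2 = m := by
    have : ∀ k, s k ^ 2 = 1 := fun k => by rcases hs k with h | h <;> rw [h] <;> norm_num
    simp [this]
  have hres : ∑ k, (mulV H x k - s k) ^ 2 ≤ (2 * κ * A ^ 2 + 2 * δ) * n := by
    calc ∑ k, (mulV H x k - s k) ^ 2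
        ≤ ∑ k, (2 * mulV H x k ^ 2 + 2 * s k ^ 2) :=
          Finset.sum_le_sum fun k _ => by nlinarith [sq_nonneg (mulV H x k + s k)]
      _ = 2 * ∑ k, mulV H x k ^ 2 + 2 * m := by
          rw [Finset.sum_add_distrib, ← Finset.mul_sum, ← Finset.mul_sum, hs2]
      _ ≤ 2 * (κ * (n * A ^ 2)) + 2 * m := by
          gcongr
          exact (h.sum_mulV_sq_le hκ x).trans (mul_le_mul_of_nonneg_left hx2 hκ)
      _ = _ := by rw [hmn]; ring
  calc ∑ i, (∑ k, (mulV H x k - s k) * H k i + lam * x i) ^ 2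
      ≤ ∑ i, (2 * (∑ k, (mulV H x k - s k) * H k i) ^ 2 + 2 * lam ^ 2 * x i ^ 2) :=
        Finset.sum_le_sum fun i _ => by
          nlinarith [sq_nonneg (∑ k, (mulV H x k - s k) * H k i - lam * x i)]
    _ = 2 * ∑ i, (∑ k, (mulV H x k - s k) * H k i) ^ 2 + 2 * lam ^ 2 * ∑ i, x i ^ 2 := by
        rw [Finset.sum_add_distrib, ← Finset.mul_sum, ← Finset.mul_sum]
    _ ≤ 2 * (κ * ((2 * κ * A ^ 2 + 2 * δ) * n)) + 2 * lam ^ 2 * (n * A ^ 2) := by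
        gcongr
        exact (h.sum_transpose_sq_le hκ _).trans (mul_le_mul_of_nonneg_left hres hκ)
    _ = _ := by ring

theorem abs_sign_sub_sign_le (a b : ℝ) : |Real.sign a - Real.sign b| ≤ 2 := by
  rcases Real.sign_apply_eq a with h | h | h <;> rcases Real.sign_apply_eq b with h' | h' | h' <;>
    rw [h, h'] <;> norm_num

/-- with probability at least `1 − C e^{−cn}` over `H`, every box-constrained
`x` with few small entries admits a nearby `y` with no small entries, comparable cost, and
comparable quantized distortion. -/
theorem stmt12 (δ lam A L Cu : ℝ) (hδ : 0 < δ) (hlam : 0 ≤ lam) (hA : 0 < A) (hL : 0 < L)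
    (hCu : 0 < Cu) :
    ∃ C c Ct ε₀ : ℝ, 0 < C ∧ 0 < c ∧ 0 < Ct ∧ 0 < ε₀ ∧ ε₀ < 1 ∧
      ∀ (n m : ℕ), (m : ℝ) = δ * n →
        ∀ s : Fin m → ℝ, (∀ k, s k = 1 ∨ s k = -1) →
          ∀ ε : ℝ, 0 < ε → ε < ε₀ →
            1 - ENNReal.ofReal (C * Real.exp (-c * n)) ≤
              matMeasure m n
                {H : Fin m → Fin n → ℝ | ∀ x : Fin n → ℝ,
                  (∀ i, |x i| ≤ A) →
                  ((Set.ncard {i : Fin n | |x i| ≤ L * ε ^ 2} : ℝ) ≤ Cu * n * ε ^ 2) →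
                  ∃ y : Fin n → ℝ, (∀ i, |y i| ≤ A) ∧
                    |cost1 m n lam s H x - cost1 m n lam s H y| ≤
                      Ct * max (ε ^ 6) (ε ^ 2 / Real.sqrt n) ∧
                    (∑ k, (mulV H (fun i => L * Real.sign (x i)) k -
                        mulV H (fun i => L * Real.sign (y i)) k) ^ 2) / m ≤ Ct * ε ^ 2 ∧
                    (∑ i, (x i - y i) ^ 2) / n ≤ Ct * ε ^ 6 ∧
                    (∀ i, y i ∉ Set.Ioo (-(L * ε ^ 2)) (L * ε ^ 2))} := by
  obtain ⟨κ, hκ, hprob⟩ := exists_measure_not_bilinBound_le δ hδ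
  set Γ : ℝ := 2 * κ * (2 * κ * A ^ 2 + 2 * δ) + 2 * lam ^ 2 * A ^ 2 with hΓ
  have hΓ0 : 0 < Γ := by positivity
  set D : ℝ := 4 * Cu * L ^ 2 with hD
  have hD0 : 0 < D := by positivity
  set C₁ : ℝ := 2 * L * √Γ + (κ + lam) * D with hC₁
  have hC₁0 : 0 < C₁ := by positivity
  have hC₂0 : 0 < κ * D / δ := by positivity
  refine ⟨1, 1, C₁ + κ * D / δ + D, min (1 / 2) (A / L), one_pos, one_pos, by positivity,
    lt_min (by norm_num) (by positivity), (min_le_left _ _).trans_lt (by norm_num), ?_⟩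
  intro n m hmn s hs ε hε hε₀
  rcases Nat.eq_zero_or_pos n with rfl | hn
  · simp
  have hn' : (0 : ℝ) < n := by exact_mod_cast hn
  have haA : L * ε ^ 2 ≤ A := by
    have h1 : ε < A / L := hε₀.trans_le (min_le_right _ _)
    have h2 : ε < 1 / 2 := hε₀.trans_le (min_le_left _ _)
    have h3 : ε ^ 2 ≤ ε := by nlinarith
    calc L * ε ^ 2 ≤ L * (A / L) := by gcongr; linarith
      _ = A := by field_simp
  have hbad := hprob n m hn hmn
  rw [one_mul, neg_one_mul]
  refine tsub_le_iff_right.2 ?_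
  refine le_trans ?_ (add_le_add_right hbad _)
  rw [← measure_univ (μ := matMeasure m n)]
  refine (measure_mono fun H _ => ?_).trans (measure_union_le _ _)
  by_cases hH : BilinBound κ H
  swap
  · exact Or.inr hH
  refine Or.inl ?_
  intro x hxA hcard
  classical
  set a : ℝ := L * ε ^ 2 with ha
  have ha0 : 0 < a := by positivity
  set S : Finset (Fin n) := Finset.univ.filter fun i => |x i| ≤ a with hS
  have hSx : ∀ i ∈ S, |x i| ≤ a := fun i hi => (Finset.mem_filter.1 hi).2
  have hScard : (S.card : ℝ) ≤ Cu * n * ε ^ 2 := by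
    refine le_of_eq_of_le ?_ hcard
    rw [← Set.ncard_coe_finset, hS]
    simp
  set g : Fin n → ℝ := fun i => ∑ k, (mulV H x k - s k) * H k i + lam * x i with hg
  obtain ⟨y, hyS, hy, hlin⟩ := exists_rounding_to_threshold S x g a hSx
  have hyabs : ∀ i ∈ S, |y i| = a := fun i hi => by
    rcases hyS i hi with h | h <;> simp [h, abs_of_pos ha0]
  have hsum_sq : ∑ i, (y i - x i) ^ 2 ≤ D * n * ε ^ 6 := by
    refine (sum_sq_le_of_support S _ (2 * a)
      (fun i hi => (abs_sub _ _).trans ?_) fun i hi => by rw [hy i hi, sub_self]).trans ?_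
    · linarith [hyabs i hi, hSx i hi]
    · calc (S.card : ℝ) * (2 * a) ^ 2 ≤ Cu * n * ε ^ 2 * (2 * a) ^ 2 := by gcongr
        _ = D * n * ε ^ 6 := by rw [ha, hD]; ring
  have hHd : ∑ k, mulV H (fun i => y i - x i) k ^ 2 ≤ κ * (D * n * ε ^ 6) :=
    (hH.sum_mulV_sq_le hκ.le _).trans (mul_le_mul_of_nonneg_left hsum_sq hκ.le)
  have hlin' : |∑ i, (y i - x i) * g i| ≤ a * (√Γ * √n) := by
    refine abs_le_of_sq_le_sq ?_ (by positivity)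
    rw [← Finset.sum_subset (Finset.subset_univ S) fun i _ hi => by
      rw [hy i hi, sub_self, zero_mul]]
    refine hlin.trans ?_
    rw [mul_pow a, mul_pow (√Γ), sq_sqrt hΓ0.le, sq_sqrt hn'.le]
    gcongr
    exact (Finset.sum_le_univ_sum_of_nonneg fun i => sq_nonneg _).trans
      (hH.sum_grad_sq_le hκ.le hmn hs hxA)
  refine ⟨y, fun i => ?_, ?_, ?_, ?_, fun i => ?_⟩
  · by_cases hi : i ∈ S
    · rw [hyabs i hi]; exact haA
    · rw [hy i hi]; exact hxA i
  · set M := max (ε ^ 6) (ε ^ 2 / √n) with hM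
    have hM0 : 0 ≤ M := le_max_of_le_left (by positivity)
    have hsq0 : 0 ≤ ∑ i, (y i - x i) ^ 2 := Finset.sum_nonneg fun _ _ => sq_nonneg _
    have hHd0 : 0 ≤ ∑ k, mulV H (fun i => y i - x i) k ^ 2 :=
      Finset.sum_nonneg fun _ _ => sq_nonneg _
    rw [abs_sub_comm, cost1_sub, abs_div, abs_of_pos hn']
    calc _ ≤ (2 * (a * (√Γ * √n)) + κ * (D * n * ε ^ 6) + lam * (D * n * ε ^ 6)) / n := by
          gcongr
          refine (abs_add_three _ _ _).trans ?_
          rw [abs_mul, abs_of_nonneg hHd0, abs_of_nonneg (mul_nonneg hlam hsq0), abs_two]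
          gcongr
      _ = 2 * L * √Γ * (ε ^ 2 / √n) + (κ + lam) * D * ε ^ 6 := by
          have hsn : √(n : ℝ) ^ 2 = n := sq_sqrt hn'.le
          have hsn0 : 0 < √(n : ℝ) := sqrt_pos.2 hn'
          rw [ha]
          field_simp
          linear_combination 2 * L * √Γ * hsn
      _ ≤ 2 * L * √Γ * M + (κ + lam) * D * M := by
          gcongr
          · exact le_max_right _ _
          · exact le_max_left _ _
      _ = C₁ * M := by rw [hC₁]; ring
      _ ≤ (C₁ + κ * D / δ + D) * M := by gcongr; linarith
  · simp only [← mulV_sub]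
    have hsgn : ∑ i, (L * Real.sign (x i) - L * Real.sign (y i)) ^ 2 ≤ D * n * ε ^ 2 := by
      refine (sum_sq_le_of_support S _ (L * 2) (fun i _ => ?_)
        fun i hi => by rw [hy i hi, sub_self]).trans ?_
      · rw [← mul_sub, abs_mul, abs_of_pos hL]
        exact mul_le_mul_of_nonneg_left (abs_sign_sub_sign_le _ _) hL.le
      · calc (S.card : ℝ) * (L * 2) ^ 2 ≤ Cu * n * ε ^ 2 * (L * 2) ^ 2 := by gcongr
          _ = D * n * ε ^ 2 := by rw [hD]; ring
    calc _ ≤ κ * (D * n * ε ^ 2) / m := by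
          gcongr
          exact (hH.sum_mulV_sq_le hκ.le _).trans (mul_le_mul_of_nonneg_left hsgn hκ.le)
      _ = κ * D / δ * ε ^ 2 := by rw [hmn]; field_simp
      _ ≤ _ := by gcongr; linarith
  · have hcomm : ∑ i, (x i - y i) ^ 2 = ∑ i, (y i - x i) ^ 2 :=
      Finset.sum_congr rfl fun i _ => by ring
    rw [hcomm]
    calc _ ≤ D * n * ε ^ 6 / n := by gcongr
      _ = D * ε ^ 6 := by field_simp
      _ ≤ _ := by gcongr; linarith
  · rw [Set.mem_Ioo, ← abs_lt, not_lt]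
    by_cases hi : i ∈ S
    · rw [hyabs i hi]
    · rw [hy i hi]
      exact le_of_not_ge fun h => hi (Finset.mem_filter.2 ⟨Finset.mem_univ i, h⟩)
end
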